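/- For w̃ ∈ Wtf, one has w̃ ∈ Adm(η) if and only if there exist w′ ∈ Wf and w̃₁, w̃₂ ∈ Wtf⁺ with w̃₁ ↑ w̃_h^{−1} w̃₂ such that w̃ = w̃₂^{−1} w′ w̃₁. -/

import Mathlib

/-!
Common setup: the extended affine Weyl group of `GL_n` (f-fold product), its dot
action on `(ℝ^n)^f`, p-alcoves, lengths, Bruhat orders (dominant and antidominant),
the up (↑) order, admissible sets, and the combinatorics of lowest alcove
presentations, following Le–Le Hung–Levin, "Weight elimination in Serre-type
conjectures".
-/

noncomputable section

namespace LLLSerre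

open scoped BigOperators

/-- `η₀ = (n-1, n-2, …, 1, 0)`. -/
def eta0 (n : ℕ) : Fin n → ℤ := fun i => (n : ℤ) - 1 - (i : ℤ)

/-- The action of a permutation on a vector: `(σ x) i = x (σ⁻¹ i)`. -/
def permAct {n : ℕ} {α : Type*} (σ : Equiv.Perm (Fin n)) (x : Fin n → α) : Fin n → α :=
  fun i => x (σ⁻¹ i)

/-- The weight lattice `Xf = (ℤ^n)^f`. -/
abbrev Xf (n f : ℕ) := Fin f → Fin n → ℤ

/-- The f-fold product of Weyl groups `Wf = (S_n)^f`. -/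
abbrev WfG (n f : ℕ) := Fin f → Equiv.Perm (Fin n)

/-- Points of `(ℝ^n)^f`. -/
abbrev RPt (n f : ℕ) := Fin f → Fin n → ℝ

/-- The extended affine Weyl group `Wtf = (X ⋊ W)^f`; the pair `(w, ν)` represents
`w t_ν`. -/
structure Wtf (n f : ℕ) where
  w : WfG n f
  t : Xf n f

/-- Multiplication in `Wtf`: `(w₁ t_{ν₁})(w₂ t_{ν₂}) = w₁w₂ t_{ν₂ + w₂⁻¹(ν₁)}`. -/
def Wtf.mul {n f : ℕ} (a b : Wtf n f) : Wtf n f :=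
  ⟨fun j => a.w j * b.w j, fun j => b.t j + permAct (b.w j)⁻¹ (a.t j)⟩

/-- Inversion in `Wtf`: `(w t_ν)⁻¹ = w⁻¹ t_{-w(ν)}`. -/
def Wtf.inv {n f : ℕ} (a : Wtf n f) : Wtf n f :=
  ⟨fun j => (a.w j)⁻¹, fun j => -(permAct (a.w j) (a.t j))⟩

/-- Embedding of the finite Weyl group `Wf` in `Wtf`. -/
def ofW {n f : ℕ} (w : WfG n f) : Wtf n f := ⟨w, fun _ _ => 0⟩

/-- The translation `t_ν ∈ Wtf`. -/
def transl {n f : ℕ} (ν : Xf n f) : Wtf n f := ⟨fun _ => 1, ν⟩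

/-- `η = (η₀, …, η₀) ∈ Xf`. -/
def etaf (n f : ℕ) : Xf n f := fun _ => eta0 n

/-- The longest element `w₀ ∈ Wf`. -/
def w0f (n f : ℕ) : WfG n f := fun _ => Fin.revPerm

/-- `w₀` as an element of `Wtf`. -/
def w0Elt (n f : ℕ) : Wtf n f := ofW (w0f n f)

/-- `w̃_h = w₀ t_{-η} ∈ Wtf`. -/
def whElt (n f : ℕ) : Wtf n f := ⟨w0f n f, fun _ i => -(eta0 n i)⟩

/-- The dot action of `Wtf` on `(ℝ^n)^f`: `(w t_ν) · x = w(x + η + pν) − η`. -/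
def dotR {n f : ℕ} (p : ℕ) (a : Wtf n f) (x : RPt n f) : RPt n f :=
  fun j i =>
    (x j ((a.w j)⁻¹ i) + ((eta0 n ((a.w j)⁻¹ i) : ℤ) : ℝ)
      + (p : ℝ) * ((a.t j ((a.w j)⁻¹ i) : ℤ) : ℝ)) - ((eta0 n i : ℤ) : ℝ)

/-- The dot action of `Wtf` on integral weights. -/
def dotZ {n f : ℕ} (p : ℕ) (a : Wtf n f) (lam : Xf n f) : Xf n f :=
  fun j i =>
    (lam j ((a.w j)⁻¹ i) + eta0 n ((a.w j)⁻¹ i) + (p : ℤ) * a.t j ((a.w j)⁻¹ i)) - eta0 n i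

/-- `⟨x_j + η₀, α_{ik}^∨⟩` for a real point `x`. -/
def prR {n f : ℕ} (x : RPt n f) (j : Fin f) (i k : Fin n) : ℝ :=
  (x j i + ((eta0 n i : ℤ) : ℝ)) - (x j k + ((eta0 n k : ℤ) : ℝ))

/-- `⟨λ_j + η₀, α_{ik}^∨⟩` for a weight `λ`. -/
def prZ {n f : ℕ} (lam : Xf n f) (j : Fin f) (i k : Fin n) : ℤ :=
  (lam j i + eta0 n i) - (lam j k + eta0 n k)

/-- A point is (p-)regular if it lies on none of the affine hyperplanes
`⟨x_j + η₀, α^∨⟩ = pm`. -/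
def regular {n f : ℕ} (p : ℕ) (x : RPt n f) : Prop :=
  ∀ (j : Fin f) (i k : Fin n) (m : ℤ), i < k → prR x j i k ≠ (p : ℝ) * (m : ℝ)

/-- Two regular points lie in the same p-alcove (same side of every hyperplane). -/
def sameAlcove {n f : ℕ} (p : ℕ) (x y : RPt n f) : Prop :=
  regular p x ∧ regular p y ∧
    ∀ (j : Fin f) (i k : Fin n) (m : ℤ), i < k →
      (prR x j i k < (p : ℝ) * (m : ℝ) ↔ prR y j i k < (p : ℝ) * (m : ℝ))

/-- The root `α_{ik} = e_i - e_k` as a real vector. -/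
def rootR {n : ℕ} (i k i' : Fin n) : ℝ :=
  (if i' = i then (1 : ℝ) else 0) - (if i' = k then (1 : ℝ) else 0)

/-- The affine reflection across the hyperplane `⟨x_j + η₀, α_{ik}^∨⟩ = pm`:
it replaces `x_j` by `x_j − (⟨x_j + η₀, α_{ik}^∨⟩ − pm) α_{ik}`. -/
def reflPt {n f : ℕ} (p : ℕ) (j : Fin f) (i k : Fin n) (m : ℤ) (x : RPt n f) : RPt n f :=
  fun j' i' =>
    if j' = j then x j' i' - (prR x j i k - (p : ℝ) * (m : ℝ)) * rootR i k i' else x j' i'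

/-- The origin, a point of the base alcove `C₀` (when `p > n`). -/
def basePt (n f : ℕ) : RPt n f := fun _ _ => 0

/-- The hyperplane indexed by `(j, i, k, m)` separates `x` from `y`. -/
def separates {n f : ℕ} (p : ℕ) (x y : RPt n f) (j : Fin f) (i k : Fin n) (m : ℤ) : Prop :=
  (prR x j i k < (p : ℝ) * (m : ℝ) ∧ (p : ℝ) * (m : ℝ) < prR y j i k) ∨
  (prR y j i k < (p : ℝ) * (m : ℝ) ∧ (p : ℝ) * (m : ℝ) < prR x j i k)

/-- The length of `a ∈ Wtf` measured from the alcove of the base point `x`: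
the number of hyperplanes separating the alcove of `x` from its image under `a`. -/
def lenFrom {n f : ℕ} (p : ℕ) (x : RPt n f) (a : Wtf n f) : ℕ :=
  Set.ncard {q : Fin f × Fin n × Fin n × ℤ |
    q.2.1 < q.2.2.1 ∧ separates p x (dotR p a x) q.1 q.2.1 q.2.2.1 q.2.2.2}

/-- Length relative to the dominant base alcove `C₀`. -/
def len {n f : ℕ} (p : ℕ) (a : Wtf n f) : ℕ := lenFrom p (basePt n f) a

/-- A point of the antidominant base alcove `w₀ · C₀`. -/
def antiBasePt (n f p : ℕ) : RPt n f := dotR p (w0Elt n f) (basePt n f)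

/-- Length relative to the antidominant base alcove `w₀ · C₀`. -/
def lenV {n f : ℕ} (p : ℕ) (a : Wtf n f) : ℕ := lenFrom p (antiBasePt n f p) a

/-- The affine Weyl group `Waf = (Λ_R ⋊ W)^f ⊆ Wtf`. -/
def Waf (n f : ℕ) : Set (Wtf n f) := {a | ∀ j, (∑ i, a.t j i) = 0}

/-- The stabilizer `Ωf` of the dominant base alcove `C₀`. -/
def Omegaf (n f p : ℕ) : Set (Wtf n f) :=
  {a | sameAlcove p (basePt n f) (dotR p a (basePt n f))}

/-- The stabilizer of the antidominant base alcove `w₀ · C₀`. -/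
def OmegaV (n f p : ℕ) : Set (Wtf n f) :=
  {a | sameAlcove p (antiBasePt n f p) (dotR p a (antiBasePt n f p))}

/-- `a ∈ Wtf` acts via the dot action as the affine reflection in a single hyperplane. -/
def isRefl {n f : ℕ} (p : ℕ) (a : Wtf n f) : Prop :=
  ∃ (j : Fin f) (i k : Fin n) (m : ℤ), i < k ∧ ∀ x, dotR p a x = reflPt p j i k m x

/-- One step of the Bruhat order (relative to the base point `x`):
`u < r u` for `r` a reflection with `ℓ(u) < ℓ(r u)`. -/
def bruhatStepFrom {n f : ℕ} (p : ℕ) (x : RPt n f) (u v : Wtf n f) : Prop :=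
  ∃ r, isRefl p r ∧ v = Wtf.mul r u ∧ lenFrom p x u < lenFrom p x v

/-- The Bruhat order on `Wtf` relative to the base alcove with representative
point `x` and stabilizer `Ω`: on `Waf` it is generated by the reflection steps,
and is extended to `Wtf` by `u ω ≤ v ω` for `u ≤ v` in `Waf`, `ω ∈ Ω`. -/
def bruhatLEFrom {n f : ℕ} (p : ℕ) (x : RPt n f) (Om : Set (Wtf n f)) (a b : Wtf n f) : Prop :=
  ∃ u v ω, u ∈ Waf n f ∧ v ∈ Waf n f ∧ ω ∈ Om ∧
    a = Wtf.mul u ω ∧ b = Wtf.mul v ω ∧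
    Relation.ReflTransGen (bruhatStepFrom p x) u v

/-- The Bruhat order on `Wtf` relative to the dominant base alcove. -/
def bruhatLE {n f : ℕ} (p : ℕ) (a b : Wtf n f) : Prop :=
  bruhatLEFrom p (basePt n f) (Omegaf n f p) a b

/-- The Bruhat order on `Wtf` relative to the antidominant base alcove. -/
def bruhatLEV {n f : ℕ} (p : ℕ) (a b : Wtf n f) : Prop :=
  bruhatLEFrom p (antiBasePt n f p) (OmegaV n f p) a b

/-- The admissible set `Adm(λ) = {w̃ : w̃ ≤ t_{σ(λ)} for some σ ∈ Wf}` (dominant order). -/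
def Adm {n f : ℕ} (p : ℕ) (lam : Xf n f) : Set (Wtf n f) :=
  {a | ∃ σ : WfG n f, bruhatLE p a (transl (fun j => permAct (σ j) (lam j)))}

/-- The admissible set `Adm∨(λ)` (antidominant order). -/
def AdmV {n f : ℕ} (p : ℕ) (lam : Xf n f) : Set (Wtf n f) :=
  {a | ∃ σ : WfG n f, bruhatLEV p a (transl (fun j => permAct (σ j) (lam j)))}

/-- The anti-automorphism `w̃ = w t_ν ↦ w̃* = t_{ν*} w*` of `Wtf`, where
`(w*)_j = (w_{f-1-j})⁻¹` and `(ν*)_j = ν_{f-1-j}`. -/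
def wstar {n f : ℕ} (a : Wtf n f) : Wtf n f :=
  ⟨fun j => (a.w (Fin.rev j))⁻¹, fun j => permAct (a.w (Fin.rev j)) (a.t (Fin.rev j))⟩

/-- `ν ↦ ν*` on weights: `(ν*)_j = ν_{f-1-j}`. -/
def xstar {n f : ℕ} (lam : Xf n f) : Xf n f := fun j => lam (Fin.rev j)

/-- The cyclic shift `π` on weights: `(πν)_j = ν_{j-1}`. -/
def sh {n f : ℕ} (ν : Xf n f) : Xf n f := fun j => ν ((finRotate f)⁻¹ j)

/-- The cyclic shift `π` on `Wf`: `(πσ)_j = σ_{j-1}`. -/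
def shW {n f : ℕ} (σ : WfG n f) : WfG n f := fun j => σ ((finRotate f)⁻¹ j)

/-- The `Wf`-part of `^(ν,σ)(w, μ)`, namely `σ w π(σ)⁻¹`. -/
def conjW {n f : ℕ} (σ w : WfG n f) : WfG n f := fun j => σ j * w j * (shW σ j)⁻¹

/-- The `Xf`-part of `^(ν,σ)(w, μ)`, namely `σ(μ) + pν − σwπ(σ)⁻¹ π(ν)`. -/
def conjX {n f : ℕ} (p : ℕ) (ν : Xf n f) (σ w : WfG n f) (μ : Xf n f) : Xf n f :=
  fun j i => permAct (σ j) (μ j) i + (p : ℤ) * ν j i - permAct (conjW σ w j) (sh ν j) i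

/-- `(w, μ) ∼ (w', μ')`: `(w', μ') = ^(ν,σ)(w, μ)` for some `(ν, σ)`. -/
def pairEquiv {n f : ℕ} (p : ℕ) (w : WfG n f) (μ : Xf n f) (w' : WfG n f) (μ' : Xf n f) : Prop :=
  ∃ (ν : Xf n f) (σ : WfG n f), w' = conjW σ w ∧ μ' = conjX p ν σ w μ

/-- `λ` is m-deep in the base alcove `C₀`:
`m < ⟨λ_j + η₀, α^∨⟩ < p − m` for all `j` and positive coroots `α^∨`. -/
def deep {n f : ℕ} (p m : ℕ) (lam : Xf n f) : Prop :=
  ∀ (j : Fin f) (i k : Fin n), i < k →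
    (m : ℤ) < prZ lam j i k ∧ prZ lam j i k < (p : ℤ) - (m : ℤ)

/-- `λ` lies m-deep in its own p-alcove. -/
def deepInAlcove {n f : ℕ} (p m : ℕ) (lam : Xf n f) : Prop :=
  ∀ (j : Fin f) (i k : Fin n), i < k →
    ∃ N : ℤ, (p : ℤ) * N + (m : ℤ) < prZ lam j i k ∧
      prZ lam j i k < (p : ℤ) * (N + 1) - (m : ℤ)

/-- The p-restricted weights `X₁`. -/
def X1 (n f p : ℕ) : Set (Xf n f) :=
  {lam | ∀ (j : Fin f) (i : Fin n) (h : (i : ℕ) + 1 < n),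
    0 ≤ lam j i - lam j ⟨(i : ℕ) + 1, h⟩ ∧ lam j i - lam j ⟨(i : ℕ) + 1, h⟩ ≤ (p : ℤ) - 1}

/-- `X⁰`: weights pairing to 0 with every coroot. -/
def X0 (n f : ℕ) : Set (Xf n f) := {lam | ∀ (j : Fin f) (i k : Fin n), lam j i = lam j k}

/-- The alcove of the regular point `x` is dominant. -/
def dominantPt {n f : ℕ} (x : RPt n f) : Prop :=
  ∀ (j : Fin f) (i k : Fin n), i < k → 0 < prR x j i k

/-- The alcove of the regular point `x` is p-restricted. -/
def restrictedPt {n f : ℕ} (p : ℕ) (x : RPt n f) : Prop :=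
  ∀ (j : Fin f) (i : Fin n) (h : (i : ℕ) + 1 < n),
    0 < prR x j i ⟨(i : ℕ) + 1, h⟩ ∧ prR x j i ⟨(i : ℕ) + 1, h⟩ < (p : ℝ)

/-- `Wtf⁺`: the elements sending `C₀` to a dominant alcove under the dot action. -/
def WtfPlus (n f p : ℕ) : Set (Wtf n f) := {a | dominantPt (dotR p a (basePt n f))}

/-- One step of the up (↑) order on alcoves, via representative points:
stay in the same alcove, or apply a reflection across a hyperplane lying above. -/
def upStep {n f : ℕ} (p : ℕ) (x y : RPt n f) : Prop :=
  sameAlcove p x y ∨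
    ∃ (j : Fin f) (i k : Fin n) (m : ℤ), i < k ∧ prR x j i k < (p : ℝ) * (m : ℝ) ∧
      y = reflPt p j i k m x

/-- The up (↑) order on p-alcoves, via representative points. -/
def alcoveLE {n f : ℕ} (p : ℕ) (x y : RPt n f) : Prop :=
  Relation.ReflTransGen (upStep p) x y

/-- `w̃₁ ↑ w̃₂` on `Wtf`: `w̃₁ · C₀ ↑ w̃₂ · C₀` and `w̃₁, w̃₂` in the same right
`Waf`-coset. -/
def upOrd {n f : ℕ} (p : ℕ) (a b : Wtf n f) : Prop :=
  alcoveLE p (dotR p a (basePt n f)) (dotR p b (basePt n f)) ∧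
    Wtf.mul a (Wtf.inv b) ∈ Waf n f

/-- Realification of an integral weight. -/
def toR {n f : ℕ} (lam : Xf n f) : RPt n f := fun j i => ((lam j i : ℤ) : ℝ)

/-- The `Wf`-orbit of a point of `(ℝ^n)^f`. -/
def orbitR {n f : ℕ} (y : RPt n f) : Set (RPt n f) :=
  Set.range fun σ : WfG n f => fun j => permAct (σ j) (y j)

end LLLSerre

namespace LLLSerre

variable {n f p : ℕ}

instance : Mul (Wtf n f) := ⟨Wtf.mul⟩

instance : One (Wtf n f) := ⟨⟨1, 0⟩⟩

instance : Inv (Wtf n f) := ⟨Wtf.inv⟩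

theorem Wtf.ext' {a b : Wtf n f} (hw : ∀ j i, a.w j i = b.w j i)
    (ht : ∀ j i, a.t j i = b.t j i) : a = b := by
  cases a; cases b
  simp only [Wtf.mk.injEq]
  exact ⟨funext fun j => Equiv.ext (hw j), funext fun j => funext (ht j)⟩

@[simp] theorem mul_w (a b : Wtf n f) (j : Fin f) : (a * b).w j = a.w j * b.w j := rfl

@[simp] theorem mul_t (a b : Wtf n f) (j : Fin f) (i : Fin n) :
    (a * b).t j i = b.t j i + a.t j (b.w j i) := rfl

@[simp] theorem one_w (j : Fin f) : (1 : Wtf n f).w j = 1 := rfl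

@[simp] theorem one_t (j : Fin f) (i : Fin n) : (1 : Wtf n f).t j i = 0 := rfl

@[simp] theorem inv_w (a : Wtf n f) (j : Fin f) : (a⁻¹).w j = (a.w j)⁻¹ := rfl

@[simp] theorem inv_t (a : Wtf n f) (j : Fin f) (i : Fin n) :
    (a⁻¹).t j i = -a.t j ((a.w j)⁻¹ i) := rfl

instance : Group (Wtf n f) :=
  Group.ofLeftAxioms
    (fun a b c => Wtf.ext' (by simp) (by intro j i; simp; ring))
    (fun a => Wtf.ext' (by simp) (by simp))
    (fun a => Wtf.ext' (by simp) (by simp))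

theorem mul_eq (a b : Wtf n f) : Wtf.mul a b = a * b := rfl

theorem inv_eq (a : Wtf n f) : Wtf.inv a = a⁻¹ := rfl

@[simp] theorem ofW_w (w : WfG n f) (j : Fin f) : (ofW w).w j = w j := rfl

@[simp] theorem ofW_t (w : WfG n f) (j : Fin f) (i : Fin n) : (ofW w).t j i = 0 := rfl

theorem ofW_mul (v w : WfG n f) : ofW (v * w) = ofW v * ofW w :=
  Wtf.ext' (by simp) (by simp)

theorem ofW_one : ofW (1 : WfG n f) = 1 := Wtf.ext' (by simp) (by simp)

theorem ofW_inv (w : WfG n f) : ofW w⁻¹ = (ofW w)⁻¹ := Wtf.ext' (by simp) (by simp)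

/-- The `i`-th coordinate of `a · 0 + η` in the component `j`. -/
def val (p : ℕ) (a : Wtf n f) (j : Fin f) (i : Fin n) : ℤ :=
  eta0 n ((a.w j)⁻¹ i) + p * a.t j ((a.w j)⁻¹ i)

theorem val_mul (b a : Wtf n f) (j : Fin f) (i : Fin n) :
    val p (b * a) j i = val p a j ((b.w j)⁻¹ i) + p * b.t j ((b.w j)⁻¹ i) := by
  simp [val]; ring

theorem val_ofW_mul (w : WfG n f) (a : Wtf n f) (j : Fin f) (i : Fin n) :
    val p (ofW w * a) j i = val p a j ((w j)⁻¹ i) := by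
  simp [val_mul]

theorem val_one (j : Fin f) (i : Fin n) : val p (1 : Wtf n f) j i = eta0 n i := by
  simp [val]

theorem eq_of_eta0_add_eq (hnp : n < p) {i k : Fin n} {s t : ℤ}
    (h : eta0 n i + p * s = eta0 n k + p * t) : i = k ∧ s = t := by
  have hst : s = t := by
    have hi := i.2
    have hk := k.2
    simp only [eta0] at h
    rcases lt_trichotomy s t with h1 | h1 | h1
    · have : (p : ℤ) * (t - s) ≥ p * 1 := by gcongr; omega
      rw [mul_sub] at this; omega
    · exact h1
    · have : (p : ℤ) * (s - t) ≥ p * 1 := by gcongr; omega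
      rw [mul_sub] at this; omega
  refine ⟨?_, hst⟩
  subst hst
  simp only [eta0] at h
  ext; omega

theorem val_injective (hnp : n < p) {a b : Wtf n f} (h : ∀ j i, val p a j i = val p b j i) :
    a = b := by
  have key := fun j i => eq_of_eta0_add_eq hnp (h j i)
  have hw : ∀ j, a.w j = b.w j := fun j => inv_injective (Equiv.ext fun i => (key j i).1)
  refine Wtf.ext' (fun j i => by rw [hw]) fun j i => ?_
  have := (key j (a.w j i)).2
  rw [hw] at this
  simpa using this

theorem val_sub_ne (hnp : n < p) (a : Wtf n f) (j : Fin f) {i k : Fin n} (h : i ≠ k) (m : ℤ) :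
    val p a j i - val p a j k ≠ p * m := by
  intro h1
  have h2 : eta0 n ((a.w j)⁻¹ i) + p * a.t j ((a.w j)⁻¹ i) =
      eta0 n ((a.w j)⁻¹ k) + p * (a.t j ((a.w j)⁻¹ k) + m) := by
    simp only [val] at h1; linarith
  exact h ((a.w j)⁻¹.injective (eq_of_eta0_add_eq hnp h2).1)

/-- The `l`-th coordinate of the root `e_i - e_k`. -/
def rootZ (i k l : Fin n) : ℤ := (if l = i then 1 else 0) - if l = k then 1 else 0

theorem rootZ_swap (i k l : Fin n) : rootZ k i l = -rootZ i k l := by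
  simp [rootZ]

theorem rootZ_perm (σ : Equiv.Perm (Fin n)) (i k l : Fin n) :
    rootZ (σ i) (σ k) l = rootZ i k (σ⁻¹ l) := by
  simp only [rootZ, Equiv.Perm.inv_eq_iff_eq]

theorem rootZ_left {i k : Fin n} (h : i ≠ k) : rootZ i k i = 1 := by
  simp [rootZ, h]

theorem rootZ_right {i k : Fin n} (h : i ≠ k) : rootZ i k k = -1 := by
  simp [rootZ, h.symm]

theorem rootZ_of_ne {i k l : Fin n} (hi : l ≠ i) (hk : l ≠ k) : rootZ i k l = 0 := by
  simp [rootZ, hi, hk]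

/-- An index for the hyperplane `⟨x_j + η₀, α_{ik}^∨⟩ = pm`, for an arbitrary root. -/
@[ext]
structure Hyp (n f : ℕ) where
  j : Fin f
  i : Fin n
  k : Fin n
  m : ℤ
  ne : i ≠ k

namespace Hyp

/-- The value at `a · 0` of the affine function vanishing on the hyperplane. -/
def ht (p : ℕ) (H : Hyp n f) (a : Wtf n f) : ℤ :=
  val p a H.j H.i - val p a H.j H.k - p * H.m

/-- The alcove of `a` lies on the positive side of `H`. -/
def Above (p : ℕ) (H : Hyp n f) (a : Wtf n f) : Prop := 0 < H.ht p a

/-- The affine reflection in `H`. -/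
def refl (H : Hyp n f) : Wtf n f :=
  ⟨fun j => if j = H.j then Equiv.swap H.i H.k else 1,
   fun j l => if j = H.j then H.m * rootZ H.k H.i l else 0⟩

/-- The image of `H` under `g`. -/
def act (g : Wtf n f) (H : Hyp n f) : Hyp n f :=
  ⟨H.j, g.w H.j H.i, g.w H.j H.k, H.m + g.t H.j H.i - g.t H.j H.k, by simpa using H.ne⟩

/-- The same hyperplane with the opposite orientation. -/
def neg (H : Hyp n f) : Hyp n f := ⟨H.j, H.k, H.i, -H.m, H.ne.symm⟩

theorem ht_ne_zero (hnp : n < p) (H : Hyp n f) (a : Wtf n f) : H.ht p a ≠ 0 := by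
  have := val_sub_ne hnp a H.j H.ne H.m
  simp only [ht]; omega

theorem not_above_iff (hnp : n < p) (H : Hyp n f) (a : Wtf n f) :
    ¬ H.Above p a ↔ H.ht p a < 0 := by
  have := H.ht_ne_zero hnp a
  simp only [Above]; omega

theorem val_refl_mul (H : Hyp n f) (a : Wtf n f) (j : Fin f) (i : Fin n) :
    val p (H.refl * a) j i =
      val p a j i - if j = H.j then H.ht p a * rootZ H.i H.k i else 0 := by
  rw [val_mul]
  have hne := H.ne
  by_cases hj : j = H.j
  · subst hj
    simp only [refl, if_true, Equiv.swap_inv, ht]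
    by_cases h1 : i = H.i
    · subst h1; simp [rootZ_left hne, rootZ_left hne.symm]; ring
    · by_cases h2 : i = H.k
      · subst h2; simp [rootZ_right hne, rootZ_right hne.symm]; ring
      · simp [Equiv.swap_apply_of_ne_of_ne h1 h2, rootZ_of_ne h1 h2, rootZ_of_ne h2 h1]
  · simp [refl, hj]

theorem ht_act (g : Wtf n f) (H : Hyp n f) (a : Wtf n f) :
    (H.act g).ht p (g * a) = H.ht p a := by
  simp [ht, act, val_mul]; ring

theorem above_act (g : Wtf n f) (H : Hyp n f) (a : Wtf n f) :
    (H.act g).Above p (g * a) ↔ H.Above p a := by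
  simp only [Above, ht_act]

theorem refl_act (g : Wtf n f) (H : Hyp n f) : (H.act g).refl * g = g * H.refl := by
  have key : ∀ a : Wtf n f, (H.act g).refl * (g * a) = g * (H.refl * a) := fun a => by
    refine val_injective (Nat.lt_succ_self n) fun j i => ?_
    rw [val_refl_mul, ht_act, val_mul, val_mul g, val_refl_mul]
    by_cases hj : j = H.j
    · subst hj
      simp only [act, if_true, rootZ_perm]
      ring
    · simp [act, hj]
  simpa using key 1

theorem refl_act_mul (g : Wtf n f) (H : Hyp n f) (a : Wtf n f) :
    (H.act g).refl * (g * a) = g * (H.refl * a) := by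
  rw [← mul_assoc, refl_act, mul_assoc]

theorem ht_refl_mul (H : Hyp n f) (a : Wtf n f) : H.ht p (H.refl * a) = -H.ht p a := by
  have h1 := val_refl_mul (p := p) H a H.j H.i
  have h2 := val_refl_mul (p := p) H a H.j H.k
  simp only [if_true, rootZ_left H.ne, rootZ_right H.ne] at h1 h2
  have h3 : H.ht p (H.refl * a) =
    val p (H.refl * a) H.j H.i - val p (H.refl * a) H.j H.k - p * H.m := rfl
  rw [h3, h1, h2]
  simp only [ht]; ring

theorem refl_mul_refl_mul (H : Hyp n f) (a : Wtf n f) : H.refl * (H.refl * a) = a := by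
  refine val_injective (Nat.lt_succ_self n) fun j i => ?_
  rw [val_refl_mul, val_refl_mul, ht_refl_mul]
  split_ifs <;> ring

theorem refl_inv (H : Hyp n f) : H.refl⁻¹ = H.refl := by
  rw [inv_eq_iff_mul_eq_one]
  simpa using H.refl_mul_refl_mul 1

theorem above_refl_mul (hnp : n < p) (H : Hyp n f) (a : Wtf n f) :
    H.Above p (H.refl * a) ↔ ¬ H.Above p a := by
  rw [not_above_iff hnp, Above, ht_refl_mul]; omega

theorem ht_neg (H : Hyp n f) (a : Wtf n f) : H.neg.ht p a = -H.ht p a := by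
  simp [ht, neg]; ring

theorem above_neg (hnp : n < p) (H : Hyp n f) (a : Wtf n f) :
    H.neg.Above p a ↔ ¬ H.Above p a := by
  rw [not_above_iff hnp, Above, ht_neg]; omega

theorem refl_neg (H : Hyp n f) : H.neg.refl = H.refl := by
  have key : ∀ a : Wtf n f, H.neg.refl * a = H.refl * a := fun a => by
    refine val_injective (Nat.lt_succ_self n) fun j i => ?_
    rw [val_refl_mul, val_refl_mul, ht_neg]
    by_cases hj : j = H.j
    · simp only [neg, hj, if_true, rootZ_swap H.i]; ring
    · simp [neg, hj]
  simpa using key 1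

theorem ht_refl_mul_eq (H S : Hyp n f) :
    ∃ c : ℤ, ∀ a, H.ht p (S.refl * a) = H.ht p a - c * S.ht p a := by
  refine ⟨if H.j = S.j then rootZ S.i S.k H.i - rootZ S.i S.k H.k else 0, fun a => ?_⟩
  rw [ht, val_refl_mul, val_refl_mul]
  generalize S.ht p a = s
  simp only [ht]
  split_ifs <;> ring

end Hyp

namespace Hyp

theorem act_mul (g h : Wtf n f) (H : Hyp n f) : H.act (g * h) = (H.act h).act g := by
  ext <;> simp [act]
  ring

theorem act_one (H : Hyp n f) : H.act 1 = H := by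
  ext <;> simp [act]

theorem act_injective (g : Wtf n f) : Function.Injective (act g : Hyp n f → Hyp n f) := by
  intro H H' h
  have := congrArg (act g⁻¹) h
  simpa only [← act_mul, inv_mul_cancel, act_one] using this

theorem neg_act (g : Wtf n f) (H : Hyp n f) : H.neg.act g = (H.act g).neg := by
  ext <;> simp [act, neg]
  ring

theorem neg_neg (H : Hyp n f) : H.neg.neg = H := by
  ext <;> simp [neg]

/-- The hyperplane `H` separates the alcoves of `a` and `b`. -/
def Sep (p : ℕ) (H : Hyp n f) (a b : Wtf n f) : Prop := ¬ (H.Above p a ↔ H.Above p b)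

theorem sep_neg (hnp : n < p) (H : Hyp n f) (a b : Wtf n f) :
    H.neg.Sep p a b ↔ H.Sep p a b := by
  simp only [Sep, above_neg hnp]; tauto

theorem sep_act (g : Wtf n f) (H : Hyp n f) (a b : Wtf n f) :
    (H.act g).Sep p (g * a) (g * b) ↔ H.Sep p a b := by
  simp only [Sep, above_act]

/-- The orientation of `H` given by a positive root. -/
def norm (H : Hyp n f) : Hyp n f := if H.i < H.k then H else H.neg

theorem norm_eq_or (H : Hyp n f) : H.norm = H ∨ H.norm = H.neg := by
  unfold norm; split_ifs <;> simp

theorem norm_pos (H : Hyp n f) : H.norm.i < H.norm.k := by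
  have := H.ne
  unfold norm
  split_ifs with h
  · exact h
  · exact lt_of_le_of_ne (not_lt.mp h) this.symm

theorem sep_norm (hnp : n < p) (H : Hyp n f) (a b : Wtf n f) :
    H.norm.Sep p a b ↔ H.Sep p a b := by
  rcases H.norm_eq_or with h | h <;> rw [h]
  exact sep_neg hnp H a b

theorem eq_or_eq_neg_of_norm_eq {H H' : Hyp n f} (h : H.norm = H'.norm) :
    H = H' ∨ H = H'.neg := by
  rcases H.norm_eq_or with h1 | h1 <;> rcases H'.norm_eq_or with h2 | h2 <;>
    rw [h1, h2] at h
  · exact Or.inl h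
  · exact Or.inr h
  · exact Or.inr (by rw [← h, neg_neg])
  · exact Or.inl (by rw [← neg_neg H, h, neg_neg])

/-- The index `(j, i, k, m)` of a hyperplane as a tuple. -/
def toTuple (H : Hyp n f) : Fin f × Fin n × Fin n × ℤ := (H.j, H.i, H.k, H.m)

theorem toTuple_injective : Function.Injective (toTuple : Hyp n f → _) := by
  intro H H' h
  simp only [toTuple, Prod.mk.injEq] at h
  exact Hyp.ext h.1 h.2.1 h.2.2.1 h.2.2.2

end Hyp

theorem prR_dotR_basePt (a : Wtf n f) (j : Fin f) (i k : Fin n) :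
    prR (dotR p a (basePt n f)) j i k = ((val p a j i - val p a j k : ℤ) : ℝ) := by
  simp [prR, dotR, basePt, val]

theorem dotR_one_basePt : dotR p 1 (basePt n f) = basePt n f := by
  funext j i
  simp [dotR, basePt]

theorem dotR_mul (a b : Wtf n f) (x : RPt n f) : dotR p (a * b) x = dotR p a (dotR p b x) := by
  funext j i
  simp [dotR]
  ring

theorem lt_iff_ht_neg (H : Hyp n f) (a : Wtf n f) :
    prR (dotR p a (basePt n f)) H.j H.i H.k < (p : ℝ) * (H.m : ℝ) ↔ H.ht p a < 0 := by
  rw [prR_dotR_basePt, ← sub_neg, ← Int.cast_lt (R := ℝ) (m := H.ht p a)]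
  simp [Hyp.ht]

theorem lt_iff_above (H : Hyp n f) (a : Wtf n f) :
    (p : ℝ) * (H.m : ℝ) < prR (dotR p a (basePt n f)) H.j H.i H.k ↔ H.Above p a := by
  rw [prR_dotR_basePt, ← sub_pos, Hyp.Above, ← Int.cast_lt (R := ℝ)]
  simp [Hyp.ht]

theorem separates_iff (hnp : n < p) (H : Hyp n f) (a b : Wtf n f) :
    separates p (dotR p a (basePt n f)) (dotR p b (basePt n f)) H.j H.i H.k H.m ↔
      H.Sep p a b := by
  rw [separates, lt_iff_ht_neg, lt_iff_ht_neg, lt_iff_above, lt_iff_above,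
    ← H.not_above_iff hnp, ← H.not_above_iff hnp, Hyp.Sep]
  tauto

/-- The hyperplanes separating the alcove of `a` from the base alcove. -/
def sepSet (p : ℕ) (a : Wtf n f) : Set (Hyp n f) := {H | H.i < H.k ∧ H.Sep p 1 a}

theorem len_eq (hnp : n < p) (a : Wtf n f) : len p a = (sepSet p a).ncard := by
  rw [← Set.ncard_image_of_injective _ Hyp.toTuple_injective, len, lenFrom]
  congr 1
  ext ⟨j, i, k, m⟩
  simp only [Set.mem_ofPred_eq, Set.mem_image, sepSet]
  constructor
  · rintro ⟨h1, h2⟩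
    rw [← dotR_one_basePt (p := p), ← dotR_mul, mul_one] at h2
    exact ⟨⟨j, i, k, m, h1.ne⟩, ⟨h1, (separates_iff hnp ⟨j, i, k, m, h1.ne⟩ 1 a).1 h2⟩, rfl⟩
  · rintro ⟨H, ⟨h1, h2⟩, h3⟩
    simp only [Hyp.toTuple, Prod.mk.injEq] at h3
    obtain ⟨rfl, rfl, rfl, rfl⟩ := h3
    refine ⟨h1, ?_⟩
    rw [← separates_iff hnp, dotR_one_basePt] at h2
    exact h2

theorem sepSet_finite (hnp : n < p) (a : Wtf n f) : (sepSet p a).Finite := by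
  obtain ⟨M, hM⟩ := (Set.finite_range fun q : Fin f × Fin n × Fin n =>
    |val p a q.1 q.2.1 - val p a q.1 q.2.2| + |val p 1 q.1 q.2.1 - val p 1 q.1 q.2.2|).bddAbove
  have hfin : (Set.univ ×ˢ Set.univ ×ˢ Set.univ ×ˢ Set.Icc (-M) M :
      Set (Fin f × Fin n × Fin n × ℤ)).Finite :=
    Set.finite_univ.prod (Set.finite_univ.prod (Set.finite_univ.prod (Set.finite_Icc _ _)))
  refine (hfin.preimage Hyp.toTuple_injective.injOn).subset ?_
  rintro H ⟨-, h⟩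
  have h1 : |val p a H.j H.i - val p a H.j H.k| + |val p 1 H.j H.i - val p 1 H.j H.k| ≤ M :=
    hM ⟨(H.j, H.i, H.k), rfl⟩
  have hp : (1 : ℤ) ≤ p := by omega
  simp only [Set.mem_preimage, Hyp.toTuple, Set.mem_prod, Set.mem_univ, true_and, Set.mem_Icc]
  simp only [Hyp.Sep, Hyp.Above, Hyp.ht] at h
  generalize val p a H.j H.i - val p a H.j H.k = x at *
  generalize val p 1 H.j H.i - val p 1 H.j H.k = y at *
  have h2 : |(p : ℤ) * H.m| ≤ M := by
    have := abs_le.1 (le_refl |x|)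
    have := abs_le.1 (le_refl |y|)
    have := abs_nonneg x
    have := abs_nonneg y
    rw [abs_le]
    by_cases hy : 0 < y - p * H.m <;> by_cases hx : 0 < x - p * H.m <;>
      simp only [hx, hy, not_true, not_false_eq_true, iff_true, iff_false] at h <;>
      first | exact absurd trivial h | (constructor <;> linarith)
  rw [abs_mul, Nat.abs_cast] at h2
  have h3 : 1 * |H.m| ≤ p * |H.m| := by gcongr
  have h4 : |H.m| ≤ M := by linarith
  exact abs_le.1 h4

theorem above_refl_mul_iff_of_sep (hnp : n < p) {H r : Hyp n f} {a b : Wtf n f}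
    (hr : r.Above p a ↔ r.Above p b) (h1 : H.Sep p b a) (h2 : ¬ H.Sep p b (r.refl * a)) :
    H.Above p (r.refl * b) ↔ H.Above p b := by
  obtain ⟨c, hc⟩ := H.ht_refl_mul_eq (p := p) r
  have e1 := hc a
  have e2 := hc b
  have n1 := H.ht_ne_zero hnp a
  have n2 := H.ht_ne_zero hnp b
  have n3 := H.ht_ne_zero hnp (r.refl * a)
  have n4 := r.ht_ne_zero hnp a
  have n5 := r.ht_ne_zero hnp b
  simp only [Hyp.Sep, Hyp.Above] at *
  generalize H.ht p (r.refl * a) = Hra at *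
  generalize H.ht p (r.refl * b) = Hrb at *
  generalize H.ht p a = Ha at *
  generalize H.ht p b = Hb at *
  generalize r.ht p a = ra at *
  generalize r.ht p b = rb at *
  rw [not_not] at h2
  rcases lt_or_gt_of_ne n4 with q1 | q1 <;> rcases lt_or_gt_of_ne n5 with q2 | q2 <;>
    rcases lt_or_gt_of_ne n2 with q3 | q3 <;> rcases lt_trichotomy c 0 with q4 | q4 | q4 <;>
    first
    | omega
    | (have t1 := mul_pos_of_neg_of_neg q4 q1
       have t2 := mul_pos_of_neg_of_neg q4 q2
       omega)
    | (have t1 := mul_neg_of_neg_of_pos q4 q1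
       have t2 := mul_neg_of_neg_of_pos q4 q2
       omega)
    | (have t1 := mul_pos q4 q1
       have t2 := mul_pos q4 q2
       omega)
    | (have t1 := mul_neg_of_pos_of_neg q4 q1
       have t2 := mul_neg_of_pos_of_neg q4 q2
       omega)
    | (subst q4; omega)

theorem len_lt_len_refl_mul (hnp : n < p) {r : Hyp n f} {a : Wtf n f}
    (hr : r.Above p a ↔ r.Above p 1) : len p a < len p (r.refl * a) := by
  classical
  rw [len_eq hnp, len_eq hnp]
  have inv1 : ∀ b : Wtf n f, r.refl * (r.refl * b) = b := r.refl_mul_refl_mul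
  have sepAct : ∀ (H : Hyp n f) (b c : Wtf n f),
      (H.act r.refl).Sep p b c ↔ H.Sep p (r.refl * b) (r.refl * c) := fun H b c => by
    rw [← Hyp.sep_act r.refl H, inv1, inv1]
  have key : ∀ H : Hyp n f, H.Sep p 1 a → ¬ H.Sep p 1 (r.refl * a) →
      (H.act r.refl).Sep p 1 (r.refl * a) ∧ ¬ (H.act r.refl).Sep p 1 a := by
    intro H h1 h2
    have h3 := above_refl_mul_iff_of_sep hnp hr h1 h2
    rw [sepAct, sepAct, inv1]
    simp only [Hyp.Sep] at *
    tauto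
  set φ : Hyp n f → Hyp n f := fun H =>
    if H.Sep p 1 (r.refl * a) then H else (H.act r.refl).norm with hφ
  have hinj : Set.InjOn φ (sepSet p a) := by
    rintro H ⟨hp1, hs1⟩ H' ⟨hp2, hs2⟩ h
    simp only [hφ] at h
    split_ifs at h with c1 c2 c2
    · exact h
    · exact absurd ((Hyp.sep_norm hnp _ 1 a).1 (h ▸ hs1)) (key H' hs2 c2).2
    · exact absurd ((Hyp.sep_norm hnp _ 1 a).1 (h ▸ hs2)) (key H hs1 c1).2
    · rcases Hyp.eq_or_eq_neg_of_norm_eq h with h | h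
      · exact Hyp.act_injective _ h
      · rw [← Hyp.neg_act] at h
        have := Hyp.act_injective _ h
        rw [this] at hp1
        exact absurd hp1 (not_lt.2 hp2.le)
  rw [← hinj.ncard_image]
  refine Set.ncard_lt_ncard ?_ (sepSet_finite hnp _)
  have hnr : ¬ r.Sep p 1 a := fun h => h hr.symm
  refine (Set.ssubset_iff_of_subset ?_).2 ⟨r.norm, ⟨r.norm_pos, ?_⟩, ?_⟩
  · rintro _ ⟨H, ⟨hp1, hs1⟩, rfl⟩
    simp only [hφ]
    split_ifs with c
    · exact ⟨hp1, c⟩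
    · exact ⟨Hyp.norm_pos _, (Hyp.sep_norm hnp _ _ _).2 (key H hs1 c).1⟩
  · rw [Hyp.sep_norm hnp, Hyp.Sep, Hyp.above_refl_mul hnp, hr]
    exact iff_not_self
  · rintro ⟨H, ⟨hp1, hs1⟩, h⟩
    simp only [hφ] at h
    split_ifs at h with c
    · rw [h, Hyp.sep_norm hnp] at hs1
      exact hnr hs1
    · have h1 : ∀ x y, (H.act r.refl).Sep p x y ↔ r.Sep p x y := fun x y => by
        rw [← Hyp.sep_norm hnp, h, Hyp.sep_norm hnp]
      have h2 := (Hyp.sep_act (p := p) r.refl H 1 a).2 hs1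
      rw [h1] at h2
      rw [Hyp.Sep, Hyp.above_refl_mul hnp, Hyp.above_refl_mul hnp, hr] at h2
      exact h2 Iff.rfl

/-- One step of the up order on elements. -/
def UpStep (p : ℕ) (a b : Wtf n f) : Prop :=
  ∃ H : Hyp n f, H.i < H.k ∧ ¬ H.Above p a ∧ b = H.refl * a

/-- The up order on elements, generated by left multiplication by reflections. -/
def Up (p : ℕ) : Wtf n f → Wtf n f → Prop := Relation.ReflTransGen (UpStep p)

theorem refl_mul_up (hnp : n < p) {H : Hyp n f} (h : H.i < H.k) {a : Wtf n f}
    (ha : H.Above p a) : Up p (H.refl * a) a :=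
  .single ⟨H, h, by rwa [H.above_refl_mul hnp, not_not], (H.refl_mul_refl_mul a).symm⟩

theorem up_whElt_inv_mul (hnp : n < p) {a b : Wtf n f} (h : Up p a b) :
    Up p ((whElt n f)⁻¹ * b) ((whElt n f)⁻¹ * a) := by
  induction h with
  | refl => exact .refl
  | tail _ hstep ih =>
    obtain ⟨H, hH, hab, rfl⟩ := hstep
    refine Relation.ReflTransGen.trans ?_ ih
    rw [← Hyp.refl_act_mul, ← Hyp.refl_neg]
    refine refl_mul_up hnp ?_ ?_
    · change Fin.revPerm.symm H.k < Fin.revPerm.symm H.i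
      simpa using hH
    · rw [Hyp.above_neg hnp, Hyp.above_act]
      exact hab

/-- The elements sending the base alcove to a dominant alcove, in coordinates. -/
def Dominant (p : ℕ) (a : Wtf n f) : Prop :=
  ∀ (j : Fin f) (i k : Fin n), i < k → val p a j k < val p a j i

theorem mem_WtfPlus_iff (a : Wtf n f) : a ∈ WtfPlus n f p ↔ Dominant p a := by
  simp only [WtfPlus, Set.mem_ofPred_eq, dominantPt, Dominant, prR_dotR_basePt, Int.cast_pos,
    sub_pos]

theorem dominant_one : Dominant p (1 : Wtf n f) := by
  intro j i k h
  rw [val_one, val_one]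
  simp only [eta0]
  omega

theorem perm_eq_one_of_strictMono {σ : Equiv.Perm (Fin n)} (h : StrictMono σ) : σ = 1 :=
  Equiv.ext fun i => DFunLike.congr_fun
    (Subsingleton.elim (h.orderIsoOfSurjective σ σ.surjective) (OrderIso.refl (Fin n))) i

theorem eq_one_of_dominant {a : Wtf n f} (ha : Dominant p a) {w : WfG n f}
    (hw : Dominant p (ofW w * a)) : w = 1 := by
  funext j
  refine inv_injective ((perm_eq_one_of_strictMono ?_).trans inv_one.symm)
  intro i k hik
  have h := hw j i k hik
  rw [val_ofW_mul, val_ofW_mul] at h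
  rcases lt_trichotomy ((w j)⁻¹ i) ((w j)⁻¹ k) with h1 | h1 | h1
  · exact h1
  · exact absurd ((w j)⁻¹.injective h1) hik.ne
  · exact absurd (ha j _ _ h1) (by omega)

theorem eq_w0f_of_antidominant {a : Wtf n f} (ha : Dominant p a) {w : WfG n f}
    (hw : ∀ (j : Fin f) (i k : Fin n), i < k →
      val p (ofW w * a) j i < val p (ofW w * a) j k) : w = w0f n f := by
  have h : (w0f n f) * w = 1 := eq_one_of_dominant ha fun j i k hik => by
    rw [ofW_mul, mul_assoc, val_ofW_mul (w0f n f), val_ofW_mul (w0f n f)]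
    exact hw j _ _ (by simpa [w0f] using hik)
  rw [mul_eq_one_iff_inv_eq] at h
  rw [← h]
  funext j
  ext i
  simp [w0f]

theorem refl_eq_ofW {H : Hyp n f} (h : H.m = 0) : ∃ s : WfG n f, H.refl = ofW s :=
  ⟨H.refl.w, Wtf.ext' (fun _ _ => rfl) (fun j i => by simp [Hyp.refl, h])⟩

theorem sum_mul_rootZ (i k : Fin n) : ∑ l : Fin n, (l : ℤ) * rootZ i k l = i - k := by
  simp [rootZ, mul_sub, Finset.sum_sub_distrib]

/-- A linear functional increasing along the positive coroots. -/
def height (p : ℕ) (a : Wtf n f) : ℤ := -∑ j, ∑ i : Fin n, (i : ℤ) * val p a j i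

theorem height_refl_mul (H : Hyp n f) (a : Wtf n f) :
    height p (H.refl * a) = height p a - H.ht p a * ((H.k : ℤ) - H.i) := by
  have h : ∑ j, ∑ i : Fin n, (i : ℤ) *
      (if j = H.j then H.ht p a * rootZ H.i H.k i else 0) = H.ht p a * ((H.i : ℤ) - H.k) := by
    rw [← sum_mul_rootZ, Finset.mul_sum, Finset.sum_eq_single H.j]
    · exact Finset.sum_congr rfl fun i _ => by rw [if_pos rfl]; ring
    · intro j _ hj
      simp [hj]
    · simp
  rw [height, height]
  simp only [Hyp.val_refl_mul, mul_sub (Nat.cast _ : ℤ), Finset.sum_sub_distrib]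
  rw [h]
  ring

theorem exists_extremal (hnp : n < p) (r : Wtf n f → Wtf n f → Prop) (ε : ℤ)
    (hε : ε = 1 ∨ ε = -1) (a : Wtf n f)
    (step : ∀ (b : Wtf n f) (H : Hyp n f), H.i < H.k → H.m = 0 → ε * H.ht p b < 0 →
      r b (H.refl * b)) :
    ∃ w : WfG n f, Relation.ReflTransGen r a (ofW w * a) ∧
      ∀ (j : Fin f) (i k : Fin n), i < k →
        0 < ε * (val p (ofW w * a) j i - val p (ofW w * a) j k) := by
  obtain ⟨w, hw, hmax⟩ := Set.exists_max_image
    {w : WfG n f | Relation.ReflTransGen r a (ofW w * a)}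
    (fun w => ε * height p (ofW w * a)) (Set.toFinite _)
    ⟨1, by rw [Set.mem_ofPred_eq, ofW_one, one_mul]⟩
  refine ⟨w, hw, fun j i k hik => ?_⟩
  by_contra hneg
  let H : Hyp n f := ⟨j, i, k, 0, hik.ne⟩
  have hht : H.ht p (ofW w * a) = val p (ofW w * a) j i - val p (ofW w * a) j k := by
    simp [H, Hyp.ht]
  have h0 := H.ht_ne_zero hnp (ofW w * a)
  rw [← hht] at hneg
  have hlt : ε * H.ht p (ofW w * a) < 0 := by
    rcases hε with rfl | rfl <;> omega
  obtain ⟨s, hs⟩ := refl_eq_ofW (H := H) rfl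
  have hstep := step _ H hik rfl hlt
  have heq : H.refl * (ofW w * a) = ofW (s * w) * a := by rw [hs, ofW_mul, mul_assoc]
  have h1 := hmax (s * w) (by
    rw [Set.mem_ofPred_eq, ← heq]
    exact Relation.ReflTransGen.tail hw hstep)
  rw [← heq, height_refl_mul] at h1
  have h2 : ε * H.ht p (ofW w * a) * ((k : ℤ) - i) < 0 :=
    mul_neg_of_neg_of_pos hlt (by have : (i : ℕ) < k := hik; omega)
  have h3 : H.k = k := rfl
  have h4 : H.i = i := rfl
  rw [h3, h4] at h1
  linarith

theorem exists_dominant_up (hnp : n < p) (a : Wtf n f) :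
    ∃ w : WfG n f, Up p a (ofW w * a) ∧ Dominant p (ofW w * a) := by
  obtain ⟨w, h1, h2⟩ := exists_extremal hnp (UpStep p) 1 (Or.inl rfl) a
    fun b H hH _ h => ⟨H, hH, (H.not_above_iff hnp b).2 (by linarith), rfl⟩
  exact ⟨w, h1, fun j i k hik => by have := h2 j i k hik; omega⟩

theorem ofW_mul_up (hnp : n < p) {a : Wtf n f} (ha : Dominant p a) (w : WfG n f) :
    Up p (ofW w * a) a := by
  obtain ⟨v, h1, h2⟩ := exists_dominant_up hnp (ofW w * a)
  rw [← mul_assoc, ← ofW_mul] at h1 h2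
  rwa [eq_one_of_dominant ha h2, ofW_one, one_mul] at h1

namespace Hyp

/-- The hyperplane parallel to `H` with index `m`. -/
def withM (H : Hyp n f) (m : ℤ) : Hyp n f := ⟨H.j, H.i, H.k, m, H.ne⟩

theorem ht_withM (H : Hyp n f) (m m' : ℤ) (a : Wtf n f) :
    (H.withM m).ht p a = (H.withM m').ht p a + p * (m' - m) := by
  simp only [ht, withM]; ring

theorem refl_withM_mul_congr (H : Hyp n f) {m m' l l' : ℤ} (h : m' - m = l' - l)
    (a : Wtf n f) :
    (H.withM m).refl * ((H.withM m').refl * a) = (H.withM l).refl * ((H.withM l').refl * a) := by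
  refine val_injective (Nat.lt_succ_self n) fun j i => ?_
  simp only [val_refl_mul, ht_withM H m m', ht_withM H l l', ht_refl_mul, h]
  rw [ht_withM H m' l']
  by_cases hj : j = H.j
  · simp only [withM, hj, if_true]
    ring
  · simp only [withM, hj, if_false]

end Hyp

theorem refl_withM_pred_mul_up (hnp : n < p) {H : Hyp n f} (hH : H.i < H.k) (q : ℤ)
    (a : Wtf n f) : Up p ((H.withM q).refl * ((H.withM (q + 1)).refl * a)) a := by
  have hp : (0 : ℤ) < p := by omega
  set x := (H.withM 0).ht p a with hx
  set e := x / p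
  have hdiv : x = p * e + x % p := (Int.mul_ediv_add_emod x p).symm
  have hmod := Int.emod_lt_of_pos x hp
  have hmod0 := Int.emod_nonneg x hp.ne'
  have h0 := (H.withM e).ht_ne_zero hnp a
  rw [H.ht_withM e 0, ← hx] at h0
  have h1 : (H.withM e).Above p a := by
    rw [Hyp.Above, H.ht_withM e 0, ← hx]
    have : (p : ℤ) * (0 - e) = -(p * e) := by ring
    omega
  have h2 : (H.withM (e - 1)).Above p ((H.withM e).refl * a) := by
    rw [Hyp.Above, H.ht_withM (e - 1) e, Hyp.ht_refl_mul, H.ht_withM e 0, ← hx]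
    have : (p : ℤ) * (0 - e) = -(p * e) := by ring
    have : (p : ℤ) * (e - (e - 1)) = p := by ring
    omega
  rw [H.refl_withM_mul_congr (l := e - 1) (l' := e) (by ring)]
  exact (refl_mul_up hnp (H := H.withM (e - 1)) hH h2).trans
    (refl_mul_up hnp (H := H.withM e) hH h1)

theorem refl_withM_neg_mul_up (hnp : n < p) {H : Hyp n f} (hH : H.i < H.k) (m : ℕ)
    (a : Wtf n f) : Up p ((H.withM (-m)).refl * ((H.withM 0).refl * a)) a := by
  induction m with
  | zero => simp only [Nat.cast_zero, neg_zero, Hyp.refl_mul_refl_mul]; exact .refl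
  | succ m ih =>
    refine Relation.ReflTransGen.trans ?_ ih
    have := refl_withM_pred_mul_up hnp hH (-(m + 1 : ℕ) : ℤ)
      ((H.withM (-m)).refl * ((H.withM 0).refl * a))
    have h2 : (-(m + 1 : ℕ) : ℤ) + 1 = -m := by push_cast; ring
    rwa [h2, Hyp.refl_mul_refl_mul] at this

theorem ofW_mul_refl_mul_up (hnp : n < p) {H : Hyp n f} (hm : 0 ≤ H.m)
    {a : Wtf n f} (ha : Dominant p a) (hHa : H.Above p a) (w : WfG n f) :
    Up p (ofW w * (H.refl * a)) a := by
  rcases lt_or_gt_of_ne (H.act (ofW w)).ne with h | h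
  · rw [← Hyp.refl_act_mul]
    exact (refl_mul_up hnp h ((Hyp.above_act _ _ _).2 hHa)).trans (ofW_mul_up hnp ha w)
  · obtain ⟨m, hm⟩ := Int.eq_ofNat_of_zero_le hm
    obtain ⟨s, hs⟩ := refl_eq_ofW (H := (H.act (ofW w)).neg.withM 0) rfl
    have h1 : (H.act (ofW w)).neg.withM (-m) = (H.act (ofW w)).neg := by
      ext <;> simp [Hyp.withM, Hyp.neg, Hyp.act, hm]
    have h2 := refl_withM_neg_mul_up hnp (H := (H.act (ofW w)).neg) h m
      (((H.act (ofW w)).neg.withM 0).refl * (ofW w * a))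
    rw [Hyp.refl_mul_refl_mul, h1, Hyp.refl_neg, Hyp.refl_act_mul, hs, ← mul_assoc (ofW s),
      ← ofW_mul] at h2
    exact h2.trans (ofW_mul_up hnp ha _)

theorem val_whElt_inv_mul (a : Wtf n f) (j : Fin f) (i : Fin n) :
    val p ((whElt n f)⁻¹ * a) j i = val p a j i.rev + p * eta0 n i := by
  rw [val_mul]
  simp [whElt, w0f]

theorem mul_transl_eq {a : Wtf n f} {σ : WfG n f}
    (h : ∀ j, a.w j = Fin.revPerm * (σ j)⁻¹) :
    a * transl (fun j => permAct (σ j) (etaf n f j)) =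
      ofW (w0f n f) * ((whElt n f)⁻¹ * a) := by
  refine val_injective (Nat.lt_succ_self n) fun j i => ?_
  rw [val_ofW_mul, val_whElt_inv_mul, val_mul]
  simp only [val, transl, permAct, etaf, w0f, h]
  simp
  ring

theorem strictAnti_of_succ_lt {g : ℕ → ℤ} (h : ∀ l, l + 1 < n → g (l + 1) < g l) {i k : ℕ}
    (hik : i < k) (hk : k < n) : g k < g i := by
  induction k, hik using Nat.le_induction with
  | base => exact h i hk
  | succ k _ ih => exact (h k hk).trans (ih (by omega))

/-- Every finite part is that of an element whose alcove is restricted. -/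
theorem exists_restricted (hnp : n < p) (s : WfG n f) :
    ∃ a : Wtf n f, a.w = s ∧ Dominant p a ∧ Dominant p ((whElt n f)⁻¹ * a) := by
  let e : Fin f → ℕ → ℤ := fun j l => if h : l < n then eta0 n ((s j)⁻¹ ⟨l, h⟩) else 0
  let ν : Fin f → ℕ → ℤ := fun j i => ∑ l ∈ Finset.range i, if e j l < e j (l + 1) then -1 else 0
  let a : Wtf n f := ⟨s, fun j i => ν j (s j i)⟩
  have hval : ∀ j (i : Fin n), val p a j i = e j i + p * ν j i := fun j i => by
    simp [val, a, e]
  have hbound : ∀ j l, l < n → 0 ≤ e j l ∧ e j l < n := fun j l hl => by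
    have := ((s j)⁻¹ ⟨l, hl⟩).2
    simp only [e, hl, dif_pos, eta0]
    omega
  have hne : ∀ j l, l + 1 < n → e j l ≠ e j (l + 1) := fun j l hl h => by
    have hl' : l < n := by omega
    simp only [e, hl, hl', dif_pos, eta0] at h
    have := (s j)⁻¹.injective (Fin.ext (by omega) :
      (s j)⁻¹ ⟨l, hl'⟩ = (s j)⁻¹ ⟨l + 1, hl⟩)
    simp at this
  have hstep : ∀ j l, l + 1 < n →
      e j (l + 1) + p * ν j (l + 1) < e j l + p * ν j l ∧
      e j l + p * ν j l < e j (l + 1) + p * ν j (l + 1) + p := fun j l hl => by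
    have h1 := hbound j l (by omega)
    have h2 := hbound j (l + 1) hl
    have h3 := hne j l hl
    have h4 : ν j (l + 1) = ν j l + if e j l < e j (l + 1) then -1 else 0 :=
      Finset.sum_range_succ _ _
    rw [h4, mul_add]
    split_ifs with h5 <;> omega
  refine ⟨a, rfl, fun j i k hik => ?_, fun j i k hik => ?_⟩
  · rw [hval, hval]
    exact strictAnti_of_succ_lt (g := fun l => e j l + p * ν j l)
      (fun l hl => (hstep j l hl).1) hik k.2
  · rw [val_whElt_inv_mul, val_whElt_inv_mul, hval, hval]
    have h := strictAnti_of_succ_lt (n := n) (g := fun l => -(e j l + p * ν j l + p * l))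
      (fun l hl => by have := (hstep j l hl).2; push_cast; rw [mul_add]; omega)
      (Fin.rev_lt_rev.2 hik) i.rev.2
    have hi : ((i.rev : ℕ) : ℤ) = eta0 n i := by
      simp only [Fin.val_rev, eta0]; omega
    have hk : ((k.rev : ℕ) : ℤ) = eta0 n k := by
      simp only [Fin.val_rev, eta0]; omega
    simp only [hi, hk] at h
    linarith

/-- The factorization `a = w₂⁻¹ w' w₁` with `w₁ ↑ w̃_h⁻¹ w₂`. -/
def Factors (p : ℕ) (a : Wtf n f) : Prop :=
  ∃ (w' : WfG n f) (w1 w2 : Wtf n f), Dominant p w1 ∧ Dominant p w2 ∧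
    Up p w1 ((whElt n f)⁻¹ * w2) ∧ a = w2⁻¹ * (ofW w' * w1)

theorem factors_transl (hnp : n < p) (σ : WfG n f) :
    Factors p (transl fun j => permAct (σ j) (etaf n f j)) := by
  obtain ⟨a, hs, h1, h2⟩ := exists_restricted hnp fun j => Fin.revPerm * (σ j)⁻¹
  refine ⟨w0f n f, (whElt n f)⁻¹ * a, a, h2, h1, .refl, ?_⟩
  rw [eq_inv_mul_iff_mul_eq]
  exact mul_transl_eq fun j => congrFun hs j

theorem exists_dominant_refl_mul_up (hnp : n < p) {H : Hyp n f} (hm : 0 ≤ H.m) {a : Wtf n f}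
    (ha : Dominant p a) (hHa : H.Above p a) :
    ∃ u : WfG n f, Dominant p (ofW u * (H.refl * a)) ∧ Up p (ofW u * (H.refl * a)) a := by
  obtain ⟨u, -, hu⟩ := exists_dominant_up hnp (H.refl * a)
  exact ⟨u, hu, ofW_mul_refl_mul_up hnp hm ha hHa u⟩

theorem Factors.refl_mul (hnp : n < p) {b : Wtf n f} (hb : Factors p b) {H : Hyp n f}
    (hH : H.Sep p 1 b) : Factors p (H.refl * b) := by
  obtain ⟨w', w1, w2, h1, h2, hup, rfl⟩ := hb
  set S := (H.act w2).norm with hS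
  have hS_refl : S.refl * w2 = w2 * H.refl := by
    rw [← Hyp.refl_act]
    rcases (H.act w2).norm_eq_or with h | h <;> rw [hS, h]
    rw [Hyp.refl_neg]
  have hS_sep : S.Sep p w2 (ofW w' * w1) := by
    have := (Hyp.sep_act w2 H _ _).2 hH
    rwa [mul_one, mul_inv_cancel_left, ← Hyp.sep_norm hnp] at this
  have hS_mul : H.refl * (w2⁻¹ * (ofW w' * w1)) = w2⁻¹ * (S.refl * (ofW w' * w1)) := by
    rw [eq_inv_mul_iff_mul_eq, ← mul_assoc w2, ← hS_refl, mul_assoc, mul_inv_cancel_left]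
  rw [hS_mul]
  have right : ∀ β : Hyp n f, 0 ≤ β.m → β.refl = S.refl → β.Above p (ofW w' * w1) →
      Factors p (w2⁻¹ * (S.refl * (ofW w' * w1))) := by
    intro β hm hβ habove
    have hact : (β.act (ofW w')⁻¹).Above p w1 := by
      rw [← Hyp.above_act (ofW w'), ← Hyp.act_mul, mul_inv_cancel, Hyp.act_one]
      exact habove
    obtain ⟨u, hu, hu_up⟩ := exists_dominant_refl_mul_up hnp (H := β.act (ofW w')⁻¹)
      (by simpa [Hyp.act, permAct] using hm) h1 hact
    refine ⟨w' * u⁻¹, _, w2, hu, h2, hu_up.trans hup, ?_⟩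
    have h3 := Hyp.refl_act_mul (ofW w') (β.act (ofW w')⁻¹) w1
    rw [← Hyp.act_mul, mul_inv_cancel, Hyp.act_one, hβ] at h3
    rw [h3, ofW_mul, ofW_inv]
    group
  have hpos : S.i < S.k := Hyp.norm_pos _
  rcases lt_or_ge S.m 0 with hm | hm
  · refine right S.neg (by simp only [Hyp.neg]; omega) S.refl_neg ?_
    have : S.Above p w2 := by
      have := h2 S.j S.i S.k hpos
      have hpm : (p : ℤ) * S.m ≤ 0 := mul_nonpos_of_nonneg_of_nonpos (by omega) hm.le
      simp only [Hyp.Above, Hyp.ht]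
      omega
    rw [Hyp.above_neg hnp]
    simpa [Hyp.Sep, this] using hS_sep
  · by_cases habove : S.Above p w2
    · obtain ⟨u, hu, hu_up⟩ := exists_dominant_refl_mul_up hnp hm h2 habove
      refine ⟨u * w', w1, _, h1, hu, hup.trans (up_whElt_inv_mul hnp hu_up), ?_⟩
      rw [ofW_mul, mul_inv_rev, mul_inv_rev, Hyp.refl_inv]
      group
    · exact right S hm rfl (by simpa [Hyp.Sep, habove] using hS_sep)

theorem dotR_refl (H : Hyp n f) (x : RPt n f) :
    dotR p H.refl x = reflPt p H.j H.i H.k H.m x := by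
  funext j l
  have hne := H.ne
  by_cases hj : j = H.j
  · subst hj
    simp only [dotR, reflPt, Hyp.refl, if_true, Equiv.swap_inv, prR]
    by_cases h1 : l = H.i
    · subst h1; simp [rootZ_left hne.symm, rootR, hne]; ring
    · by_cases h2 : l = H.k
      · subst h2; simp [rootZ_right hne.symm, rootR, hne.symm]; ring
      · simp [Equiv.swap_apply_of_ne_of_ne h1 h2, rootZ_of_ne h2 h1, rootR, h1, h2]
  · simp [dotR, reflPt, Hyp.refl, hj]

theorem dotR_basePt (a : Wtf n f) (j : Fin f) (i : Fin n) :
    dotR p a (basePt n f) j i = ((val p a j i - eta0 n i : ℤ) : ℝ) := by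
  simp [dotR, basePt, val]

theorem isRefl_iff (hnp : n < p) (r : Wtf n f) :
    isRefl p r ↔ ∃ H : Hyp n f, r = H.refl := by
  constructor
  · rintro ⟨j, i, k, m, hik, h⟩
    refine ⟨⟨j, i, k, m, hik.ne⟩, val_injective hnp fun j' i' => ?_⟩
    have h1 := congrFun (congrFun ((h (basePt n f)).trans
      (dotR_refl ⟨j, i, k, m, hik.ne⟩ (basePt n f)).symm) j') i'
    rw [dotR_basePt, dotR_basePt, Int.cast_inj] at h1
    linarith
  · rintro ⟨H, rfl⟩
    have h : H.norm.refl = H.refl := by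
      rcases H.norm_eq_or with h | h <;> rw [h]
      exact H.refl_neg
    exact ⟨_, _, _, _, H.norm_pos, fun x => by rw [← h, dotR_refl]⟩

theorem prR_swap (x : RPt n f) (j : Fin f) (i k : Fin n) : prR x j k i = -prR x j i k := by
  simp only [prR]; ring

theorem regular.ne {x : RPt n f} (hx : regular p x) (j : Fin f) {i k : Fin n} (h : i ≠ k)
    (m : ℤ) : prR x j i k ≠ p * m := by
  rcases lt_or_gt_of_ne h with h | h
  · exact hx j i k m h
  · intro h1
    refine hx j k i (-m) h ?_
    rw [prR_swap, h1]
    push_cast; ring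

theorem sameAlcove.lt_iff {x y : RPt n f} (h : sameAlcove p x y) (j : Fin f) {i k : Fin n}
    (hik : i ≠ k) (m : ℤ) : prR x j i k < p * m ↔ prR y j i k < p * m := by
  rcases lt_or_gt_of_ne hik with h1 | h1
  · exact h.2.2 j i k m h1
  · have h2 := h.2.2 j k i (-m) h1
    have h3 := h.1 j k i (-m) h1
    have h4 := h.2.1 j k i (-m) h1
    rw [prR_swap x j i k] at h2 h3
    rw [prR_swap y j i k] at h2 h4
    push_cast at h2 h3 h4
    rw [← not_iff_not, not_lt, not_lt]
    constructor
    · intro h5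
      have h6 := h2.1 (lt_of_le_of_ne (by linarith) h3)
      linarith
    · intro h5
      have h6 := h2.2 (lt_of_le_of_ne (by linarith) h4)
      linarith

theorem prR_dotR (g : Wtf n f) (x : RPt n f) (j : Fin f) (i k : Fin n) :
    prR (dotR p g x) j i k = prR x j ((g.w j)⁻¹ i) ((g.w j)⁻¹ k) +
      p * ((g.t j ((g.w j)⁻¹ i) - g.t j ((g.w j)⁻¹ k) : ℤ) : ℝ) := by
  simp only [prR, dotR]
  push_cast; ring

theorem regular.dotR {x : RPt n f} (hx : regular p x) (g : Wtf n f) :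
    regular p (dotR p g x) := by
  intro j i k m hik h
  refine hx.ne j ((g.w j)⁻¹.injective.ne hik.ne)
    (m - (g.t j ((g.w j)⁻¹ i) - g.t j ((g.w j)⁻¹ k))) ?_
  rw [prR_dotR] at h
  push_cast at h ⊢
  linarith

theorem sameAlcove.dotR {x y : RPt n f} (h : sameAlcove p x y) (g : Wtf n f) :
    sameAlcove p (dotR p g x) (dotR p g y) := by
  refine ⟨h.1.dotR g, h.2.1.dotR g, fun j i k m hik => ?_⟩
  have h1 := h.lt_iff j ((g.w j)⁻¹.injective.ne hik.ne)
    (m - (g.t j ((g.w j)⁻¹ i) - g.t j ((g.w j)⁻¹ k)))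
  rw [prR_dotR, prR_dotR]
  rw [Int.cast_sub, mul_sub, lt_sub_iff_add_lt, lt_sub_iff_add_lt] at h1
  exact h1

theorem sameAlcove.trans {x y z : RPt n f} (h : sameAlcove p x y) (h' : sameAlcove p y z) :
    sameAlcove p x z :=
  ⟨h.1, h'.2.1, fun j i k m hik => (h.2.2 j i k m hik).trans (h'.2.2 j i k m hik)⟩

theorem sameAlcove_dotR_basePt_iff (hnp : n < p) (a b : Wtf n f) :
    sameAlcove p (dotR p a (basePt n f)) (dotR p b (basePt n f)) ↔
      ∀ H : Hyp n f, H.Above p a ↔ H.Above p b := by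
  have hreg : ∀ c : Wtf n f, regular p (dotR p c (basePt n f)) := by
    intro c j i k m hik h
    rw [prR_dotR_basePt] at h
    exact val_sub_ne hnp c j hik.ne m (by exact_mod_cast h)
  constructor
  · intro h H
    have := h.lt_iff H.j H.ne H.m
    rw [lt_iff_ht_neg, lt_iff_ht_neg, ← H.not_above_iff hnp, ← H.not_above_iff hnp] at this
    exact not_iff_not.1 this
  · intro h
    refine ⟨hreg a, hreg b, fun j i k m hik => ?_⟩
    have := h ⟨j, i, k, m, hik.ne⟩
    rw [← not_iff_not, Hyp.not_above_iff hnp, Hyp.not_above_iff hnp, ← lt_iff_ht_neg,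
      ← lt_iff_ht_neg] at this
    exact this

theorem mem_Omegaf_iff (hnp : n < p) (a : Wtf n f) :
    a ∈ Omegaf n f p ↔ ∀ H : Hyp n f, H.Above p 1 ↔ H.Above p a := by
  rw [← sameAlcove_dotR_basePt_iff hnp, dotR_one_basePt]
  rfl

/-- The homomorphism to `ℤ^f` whose kernel is the affine Weyl group. -/
def tot (a : Wtf n f) (j : Fin f) : ℤ := ∑ i, a.t j i

theorem mem_Waf_iff (a : Wtf n f) : a ∈ Waf n f ↔ ∀ j, tot a j = 0 := Iff.rfl

theorem tot_mul (a b : Wtf n f) (j : Fin f) : tot (a * b) j = tot a j + tot b j := by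
  simp only [tot, mul_t, Finset.sum_add_distrib, Equiv.sum_comp (b.w j) (a.t j)]
  ring

theorem tot_inv (a : Wtf n f) (j : Fin f) : tot a⁻¹ j = -tot a j := by
  have h := tot_mul a a⁻¹ j
  rw [mul_inv_cancel] at h
  simp [tot] at h ⊢
  linarith

theorem tot_refl (H : Hyp n f) (j : Fin f) : tot H.refl j = 0 := by
  have h := tot_mul H.refl H.refl j
  have h1 := tot_inv H.refl j
  rw [H.refl_inv] at h1
  omega

theorem eq_one_of_mem_Waf_of_mem_Omegaf (hnp : n < p) {g : Wtf n f}
    (h : ∀ H : Hyp n f, H.Above p 1 ↔ H.Above p g) (ht : ∀ j, tot g j = 0) : g = 1 := by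
  have hval : ∀ j (i k : Fin n), i < k →
      val p g j k < val p g j i ∧ val p g j i < val p g j k + p := fun j i k hik => by
    have h0 := h ⟨j, i, k, 0, hik.ne⟩
    have h1 := h ⟨j, i, k, 1, hik.ne⟩
    have h2 := Hyp.ht_ne_zero hnp ⟨j, i, k, 1, hik.ne⟩ g
    simp only [Hyp.Above, Hyp.ht, val_one, eta0] at h0 h1 h2
    have := k.2
    omega
  have hτ : ∀ j (i k : Fin n), g.t j i - g.t j k ≤ 1 := fun j i k => by
    have hi : val p g j (g.w j i) = eta0 n i + p * g.t j i := by simp [val]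
    have hk : val p g j (g.w j k) = eta0 n k + p * g.t j k := by simp [val]
    have h1 : val p g j (g.w j i) < val p g j (g.w j k) + p := by
      rcases lt_trichotomy (g.w j i) (g.w j k) with h1 | h1 | h1
      · exact (hval j _ _ h1).2
      · rw [h1]; omega
      · have := (hval j _ _ h1).1; omega
    by_contra h2
    have h3 : (p : ℤ) * 2 ≤ p * (g.t j i - g.t j k) := by gcongr; omega
    rw [mul_sub] at h3
    have h4 := i.2
    have h5 := k.2
    simp only [eta0] at hi hk
    omega
  have ht0 : ∀ j i, g.t j i = 0 := fun j i => by
    have h1 := ht j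
    rw [tot] at h1
    rcases lt_trichotomy (g.t j i) 0 with h2 | h2 | h2
    · have : ∑ k, g.t j k < 0 :=
        Finset.sum_neg' (fun k _ => by have := hτ j k i; omega) ⟨i, Finset.mem_univ i, h2⟩
      omega
    · exact h2
    · have : 0 < ∑ k, g.t j k :=
        Finset.sum_pos' (fun k _ => by have := hτ j i k; omega) ⟨i, Finset.mem_univ i, h2⟩
      omega
  have hg : g = ofW g.w * 1 := Wtf.ext' (by simp) (by simp [ht0])
  have hw : g.w = 1 := eq_one_of_dominant dominant_one (p := p) (by
    rw [← hg]
    exact fun j i k hik => (hval j i k hik).1)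
  rw [hg, hw, ofW_one, one_mul]

theorem Up.upOrd (hnp : n < p) {a b : Wtf n f} (h : Up p a b) : upOrd p a b := by
  induction h with
  | refl => exact ⟨.refl, fun j => by rw [mul_eq, inv_eq, mul_inv_cancel]; simp⟩
  | tail _ hstep ih =>
    obtain ⟨H, hH, hab, rfl⟩ := hstep
    refine ⟨ih.1.tail (Or.inr ⟨H.j, H.i, H.k, H.m, hH, ?_, ?_⟩), ?_⟩
    · rw [lt_iff_ht_neg, ← H.not_above_iff hnp]
      exact hab
    · rw [dotR_mul, dotR_refl]
    · have := ih.2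
      rw [mem_Waf_iff] at this ⊢
      intro j
      have := this j
      rw [mul_eq, inv_eq, tot_mul, tot_inv] at this ⊢
      rw [tot_mul, tot_refl]
      omega

theorem exists_up_of_alcoveLE (hnp : n < p) {a : Wtf n f} {y : RPt n f}
    (h : alcoveLE p (dotR p a (basePt n f)) y) :
    ∃ c, Up p a c ∧ (∀ j, tot c j = tot a j) ∧ sameAlcove p (dotR p c (basePt n f)) y := by
  induction h with
  | refl => exact ⟨a, .refl, fun _ => rfl, (sameAlcove_dotR_basePt_iff hnp a a).2 fun _ => Iff.rfl⟩
  | @tail y' _ _ hstep ih =>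
    obtain ⟨c, hup, htot, hc⟩ := ih
    rcases hstep with hstep | ⟨j, i, k, m, hik, hlt, rfl⟩
    · exact ⟨c, hup, htot, hc.trans hstep⟩
    · let H : Hyp n f := ⟨j, i, k, m, hik.ne⟩
      refine ⟨H.refl * c, hup.tail ⟨H, hik, ?_, rfl⟩, fun j => ?_, ?_⟩
      · rw [H.not_above_iff hnp, ← lt_iff_ht_neg]
        exact (hc.2.2 j i k m hik).2 hlt
      · rw [tot_mul, tot_refl, htot, zero_add]
      · rw [dotR_mul]
        have := hc.dotR H.refl
        rwa [dotR_refl H y'] at this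

theorem upOrd_iff (hnp : n < p) (a b : Wtf n f) : upOrd p a b ↔ Up p a b := by
  refine ⟨fun ⟨h1, h2⟩ => ?_, Up.upOrd hnp⟩
  obtain ⟨c, hup, htot, hc⟩ := exists_up_of_alcoveLE hnp h1
  rw [sameAlcove_dotR_basePt_iff hnp] at hc
  have h3 : b⁻¹ * c = 1 := by
    refine eq_one_of_mem_Waf_of_mem_Omegaf hnp (fun H => ?_) fun j => ?_
    · rw [← Hyp.above_act b, mul_one, ← Hyp.above_act b H (b⁻¹ * c), mul_inv_cancel_left]
      exact (hc _).symm
    · have := (mem_Waf_iff _).1 h2 j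
      rw [mul_eq, inv_eq, tot_mul, tot_inv] at this
      rw [tot_mul, tot_inv, htot]
      omega
  rwa [inv_mul_eq_one.1 h3]

theorem above_mul_of_mem_Omegaf (hnp : n < p) {o : Wtf n f} (ho : o ∈ Omegaf n f p)
    (H : Hyp n f) (a : Wtf n f) : H.Above p (a * o) ↔ H.Above p a := by
  have h := (mem_Omegaf_iff hnp o).1 ho (H.act a⁻¹)
  rw [← Hyp.above_act a, ← Hyp.above_act a _ o, ← Hyp.act_mul, mul_inv_cancel, Hyp.act_one,
    mul_one] at h
  exact h.symm

theorem len_refl_mul_lt (hnp : n < p) {H : Hyp n f} {a : Wtf n f} (h : H.Sep p 1 a) :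
    len p (H.refl * a) < len p a := by
  have h1 := len_lt_len_refl_mul hnp (r := H) (a := H.refl * a) (by
    rw [H.above_refl_mul hnp]
    simp only [Hyp.Sep] at h
    tauto)
  rwa [H.refl_mul_refl_mul] at h1

theorem exists_eq_mul (hnp : n < p) (a : Wtf n f) :
    ∃ u o : Wtf n f, u ∈ Waf n f ∧ o ∈ Omegaf n f p ∧ a = u * o := by
  induction hl : len p a using Nat.strong_induction_on generalizing a with
  | _ l ih =>
    by_cases h : ∃ H : Hyp n f, H.Sep p 1 a
    · obtain ⟨H, hH⟩ := h
      obtain ⟨u, o, hu, ho, h1⟩ := ih _ (hl ▸ len_refl_mul_lt hnp hH) _ rfl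
      refine ⟨H.refl * u, o, ?_, ho, ?_⟩
      · rw [mem_Waf_iff] at hu ⊢
        intro j
        rw [tot_mul, tot_refl, hu, add_zero]
      · rw [mul_assoc, ← h1, H.refl_mul_refl_mul]
    · simp only [not_exists, Hyp.Sep, not_not] at h
      exact ⟨1, a, fun j => by simp, (mem_Omegaf_iff hnp a).2 h, (one_mul a).symm⟩

theorem factors_of_bruhatLE (hnp : n < p) {a b : Wtf n f} (h : bruhatLE p a b)
    (hb : Factors p b) : Factors p a := by
  obtain ⟨u, v, o, -, -, ho, rfl, rfl, hchain⟩ := h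
  induction hchain using Relation.ReflTransGen.head_induction_on with
  | refl => exact hb
  | head hstep _ ih =>
    obtain ⟨r, hr, rfl, hlen⟩ := hstep
    obtain ⟨H, rfl⟩ := (isRefl_iff hnp r).1 hr
    rw [mul_eq, mul_eq] at ih
    have := ih.refl_mul hnp (H := H) (by
      rw [Hyp.Sep, above_mul_of_mem_Omegaf hnp ho, H.above_refl_mul hnp]
      by_contra hcon
      refine absurd hlen (not_lt.2 (len_refl_mul_lt hnp ?_).le)
      simp only [Hyp.Sep]
      tauto)
    rwa [mul_assoc, H.refl_mul_refl_mul] at this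

/-- A step of the Bruhat order based at the alcove of `c`. -/
def BStep (p : ℕ) (c a b : Wtf n f) : Prop :=
  ∃ H : Hyp n f, b = H.refl * a ∧ (H.Above p a ↔ H.Above p c)

/-- The Bruhat order based at the alcove of `c`. -/
def Br (p : ℕ) (c : Wtf n f) : Wtf n f → Wtf n f → Prop := Relation.ReflTransGen (BStep p c)

theorem Br.bruhatLE (hnp : n < p) {a b : Wtf n f} (h : Br p 1 a b) : bruhatLE p a b := by
  obtain ⟨u, o, hu, ho, rfl⟩ := exists_eq_mul hnp a
  suffices h1 : ∃ v, v ∈ Waf n f ∧ b = v * o ∧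
      Relation.ReflTransGen (bruhatStepFrom p (basePt n f)) u v by
    obtain ⟨v, hv, hb, hchain⟩ := h1
    exact ⟨u, v, o, hu, hv, ho, rfl, hb, hchain⟩
  induction h with
  | refl => exact ⟨u, hu, rfl, .refl⟩
  | tail _ hstep ih =>
    obtain ⟨v, hv, rfl, hchain⟩ := ih
    obtain ⟨H, rfl, hH⟩ := hstep
    refine ⟨H.refl * v, ?_, by rw [mul_assoc], hchain.tail
      ⟨H.refl, (isRefl_iff hnp _).2 ⟨H, rfl⟩, rfl, ?_⟩⟩
    · rw [mem_Waf_iff] at hv ⊢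
      intro j
      rw [tot_mul, tot_refl, hv, add_zero]
    · rw [above_mul_of_mem_Omegaf hnp ho] at hH
      exact len_lt_len_refl_mul hnp hH

theorem Br.act {c a b : Wtf n f} (h : Br p c a b) (g : Wtf n f) :
    Br p (g * c) (g * a) (g * b) := by
  induction h with
  | refl => exact .refl
  | tail _ hstep ih =>
    obtain ⟨H, rfl, hH⟩ := hstep
    exact ih.tail ⟨H.act g, (H.refl_act_mul g _).symm, by rwa [Hyp.above_act, Hyp.above_act]⟩

namespace Hyp

theorem ht_refl_mul_cases (H S : Hyp n f) :
    (∀ a, H.ht p (S.refl * a) = H.ht p a) ∨ ∃ H' : Hyp n f, (H' = H ∨ H' = H.neg) ∧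
      (H' = S.withM H'.m ∨ (∀ a, H'.ht p (S.refl * a) = H'.ht p a - S.ht p a) ∧
        ∃ R : Hyp n f, ∀ a, R.ht p a = S.ht p a - H'.ht p a) := by
  have hS := S.ne
  have hH := H.ne
  by_cases hj : H.j = S.j
  · have key : ∀ a, H.ht p (S.refl * a) =
        H.ht p a - S.ht p a * (rootZ S.i S.k H.i - rootZ S.i S.k H.k) := fun a => by
      rw [ht, val_refl_mul, val_refl_mul, if_pos hj, if_pos hj]
      generalize S.ht p a = s
      rw [ht]
      ring
    by_cases h1 : H.i = S.i
    · by_cases h2 : H.k = S.k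
      · exact Or.inr ⟨H, Or.inl rfl, Or.inl (Hyp.ext hj h1 h2 rfl)⟩
      · refine Or.inr ⟨H, Or.inl rfl, Or.inr ⟨fun a => ?_, ⟨S.j, H.k, S.k, S.m - H.m, h2⟩,
          fun a => ?_⟩⟩
        · rw [key, h1, rootZ_left hS, rootZ_of_ne (fun h => hH (h1.trans h.symm)) h2]
          ring
        · simp only [ht, h1, hj]
          ring
    · by_cases h2 : H.k = S.k
      · refine Or.inr ⟨H, Or.inl rfl, Or.inr ⟨fun a => ?_, ⟨S.j, S.i, H.i, S.m - H.m, Ne.symm h1⟩,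
          fun a => ?_⟩⟩
        · rw [key, h2, rootZ_right hS, rootZ_of_ne h1 (fun h => hH (h.trans h2.symm))]
          ring
        · simp only [ht, h2, hj]
          ring
      · by_cases h3 : H.i = S.k
        · by_cases h4 : H.k = S.i
          · exact Or.inr ⟨H.neg, Or.inr rfl, Or.inl (Hyp.ext hj h4 h3 rfl)⟩
          · refine Or.inr ⟨H.neg, Or.inr rfl, Or.inr ⟨fun a => ?_,
              ⟨S.j, S.i, H.k, S.m + H.m, Ne.symm h4⟩, fun a => ?_⟩⟩
            · rw [ht_neg, ht_neg, key, h3, rootZ_right hS, rootZ_of_ne h4 h2]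
              ring
            · simp only [ht, neg, h3, hj]
              ring
        · by_cases h4 : H.k = S.i
          · refine Or.inr ⟨H.neg, Or.inr rfl, Or.inr ⟨fun a => ?_,
              ⟨S.j, H.i, S.k, S.m + H.m, h3⟩, fun a => ?_⟩⟩
            · rw [ht_neg, ht_neg, key, h4, rootZ_left hS, rootZ_of_ne h1 h3]
              ring
            · simp only [ht, neg, h4, hj]
              ring
          · left
            intro a
            rw [key, rootZ_of_ne h1 h3, rootZ_of_ne h4 h2]
            ring
  · left
    intro a
    simp [ht, val_refl_mul, hj]

/-- `S` is a wall of the alcove of `c`: no other hyperplane separates that alcove from its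
reflection in `S`. -/
def Wall (p : ℕ) (S : Hyp n f) (c : Wtf n f) : Prop :=
  ∀ H : Hyp n f, H = S ∨ H = S.neg ∨ (H.Above p c ↔ H.Above p (S.refl * c))

theorem exists_wall (hnp : n < p) {c a : Wtf n f} (h : ∃ H : Hyp n f, H.Sep p c a) :
    ∃ S : Hyp n f, S.Wall p c ∧ S.Sep p c a := by
  have hne : ∃ H : Hyp n f, H.Above p c ∧ ¬ H.Above p a := by
    obtain ⟨H, hH⟩ := h
    by_cases h1 : H.Above p c
    · exact ⟨H, h1, fun h2 => hH (iff_of_true h1 h2)⟩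
    · refine ⟨H.neg, ?_⟩
      rw [above_neg hnp, above_neg hnp]
      exact ⟨h1, fun h2 => hH (iff_of_false h1 h2)⟩
  obtain ⟨S, ⟨hSc, hSa⟩, hS⟩ := exists_minimalFor_of_wellFoundedLT
    (fun H : Hyp n f => H.Above p c ∧ ¬ H.Above p a) (fun H => (H.ht p c).toNat) hne
  have hmin : ∀ H : Hyp n f, H.Above p c → ¬ H.Above p a → S.ht p c ≤ H.ht p c := by
    intro H h1 h2
    have h3 : (H.ht p c).toNat ≤ (S.ht p c).toNat → (S.ht p c).toNat ≤ (H.ht p c).toNat :=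
      @hS H ⟨h1, h2⟩
    simp only [Above] at h1 hSc
    omega
  refine ⟨S, fun H => ?_, fun h => hSa (h.1 hSc)⟩
  have claim : ∀ H' : Hyp n f, (H' = S.withM H'.m ∨
      (∀ a, H'.ht p (S.refl * a) = H'.ht p a - S.ht p a) ∧
        ∃ R : Hyp n f, ∀ a, R.ht p a = S.ht p a - H'.ht p a) →
      H' = S ∨ (H'.Above p c ↔ H'.Above p (S.refl * c)) := by
    intro H' hH'
    have n1 := H'.ht_ne_zero hnp (S.refl * c)
    rcases hH' with hH' | ⟨h1, R, hR⟩
    · rw [or_iff_not_imp_left]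
      intro hne
      have hm : H'.m ≠ S.m := fun h => hne (by rw [hH', h]; rfl)
      have e1 := fun a => S.ht_withM (p := p) H'.m S.m a
      have e2 := fun a => S.ht_withM (p := p) (S.m + 1) S.m a
      have e3 : ∀ a, (S.withM S.m).ht p a = S.ht p a := fun _ => rfl
      have n2 := (S.withM (S.m + 1)).ht_ne_zero hnp c
      have h2 := hmin (S.withM (S.m + 1))
      have h3 : (p : ℤ) * (S.m - (S.m + 1)) = -p := by ring
      rw [← hH'] at e1
      simp only [Above, e1, e2, e3, h3, ht_refl_mul] at hSc hSa h2 n2 ⊢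
      rcases lt_or_gt_of_ne hm with h4 | h4
      · have h5 : (p : ℤ) * 1 ≤ p * (S.m - H'.m) := by gcongr; omega
        omega
      · have h5 : (p : ℤ) * 1 ≤ p * (H'.m - S.m) := by gcongr; omega
        have h6 : (p : ℤ) * (H'.m - S.m) = -(p * (S.m - H'.m)) := by ring
        omega
    · right
      have h2 := hmin H'
      have h3 := hmin R
      simp only [Above, hR, h1] at hSc hSa h2 h3 n1 ⊢
      omega
  rcases H.ht_refl_mul_cases (p := p) S with h1 | ⟨H', rfl | rfl, h1⟩
  · exact Or.inr (Or.inr (by simp only [Above, h1]))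
  · exact (claim H' h1).imp_right Or.inr
  · rcases claim _ h1 with h2 | h2
    · exact Or.inr (Or.inl (by rw [← h2, neg_neg]))
    · rw [above_neg hnp, above_neg hnp] at h2
      exact Or.inr (Or.inr (not_iff_not.1 h2))

end Hyp

theorem Br.lift {S : Hyp n f} {c u v : Wtf n f} (hS : S.Wall p c) (h : Br p c u v) :
    Br p c u (S.refl * v) ∨ Br p c (S.refl * u) (S.refl * v) := by
  induction h with
  | refl => exact Or.inr .refl
  | @tail v _ huv hstep ih =>
    obtain ⟨R, rfl, hR⟩ := hstep
    have same : R.refl = S.refl → Br p c u (S.refl * (R.refl * v)) := fun h => by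
      rw [h, S.refl_mul_refl_mul]; exact huv
    rcases hS R with rfl | rfl | h
    · exact Or.inl (same rfl)
    · exact Or.inl (same S.refl_neg)
    · have hstep : BStep p c (S.refl * v) (S.refl * (R.refl * v)) := by
        refine ⟨R.act S.refl, (R.refl_act_mul _ _).symm, ?_⟩
        have h1 := R.above_act (p := p) S.refl (S.refl * c)
        rw [S.refl_mul_refl_mul] at h1
        rw [Hyp.above_act, hR, h, h1]
      exact ih.imp (·.tail hstep) (·.tail hstep)

theorem Br.adjacent (hnp : n < p) {S : Hyp n f} {c b t : Wtf n f} (hS : S.Wall p c)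
    (hb : S.Sep p c b) (h : Br p c b t) : Br p (S.refl * c) b t := by
  have h1 : Br p c (S.refl * b) (S.refl * t) := by
    rcases h.lift hS with h1 | h1
    · refine Relation.ReflTransGen.head ⟨S, (S.refl_mul_refl_mul b).symm, ?_⟩ h1
      rw [S.above_refl_mul hnp]
      simp only [Hyp.Sep] at hb
      tauto
    · exact h1
  have h2 := h1.act S.refl
  rwa [S.refl_mul_refl_mul, S.refl_mul_refl_mul] at h2

theorem Br.change_base (hnp : n < p) {c a b t : Wtf n f}
    (hsep : ∀ H : Hyp n f, H.Sep p c a → H.Sep p c b) (h : Br p c b t) : Br p a b t := by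
  induction hl : len p (c⁻¹ * a) using Nat.strong_induction_on generalizing c with
  | _ l ih =>
    by_cases hex : ∃ H : Hyp n f, H.Sep p c a
    · obtain ⟨S, hS, hSa⟩ := Hyp.exists_wall hnp hex
      refine ih (len p ((S.refl * c)⁻¹ * a)) ?_ (c := S.refl * c) (fun H hH => ?_)
        (h.adjacent hnp hS (hsep S hSa)) rfl
      · have h1 := (Hyp.sep_act (p := p) c⁻¹ S c a).2 hSa
        rw [inv_mul_cancel] at h1
        rw [← hl, mul_inv_rev, mul_assoc, S.refl_inv, ← Hyp.refl_act_mul]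
        exact len_refl_mul_lt hnp h1
      · rcases hS H with rfl | rfl | h1
        · simp only [Hyp.Sep, Hyp.above_refl_mul hnp] at hSa hH
          tauto
        · simp only [Hyp.Sep, Hyp.above_neg hnp, Hyp.above_refl_mul hnp] at hSa hH
          tauto
        · rw [Hyp.Sep, ← h1] at hH ⊢
          exact hsep H hH
    · simp only [not_exists, Hyp.Sep, not_not] at hex
      exact Relation.ReflTransGen.mono (p := BStep p a)
        (fun _ _ ⟨H, h1, h2⟩ => ⟨H, h1, h2.trans (hex H)⟩) _ _ h

theorem Up.exists_br {a b : Wtf n f} (h : Up p a b) :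
    ∃ N : ℤ, ∀ c : Wtf n f, (∀ (j : Fin f) (i k : Fin n), i < k →
      val p c j i - val p c j k < -N) → Br p c a b := by
  induction h with
  | refl => exact ⟨0, fun _ _ => .refl⟩
  | tail _ hstep ih =>
    obtain ⟨N, hN⟩ := ih
    obtain ⟨H, hH, hab, rfl⟩ := hstep
    refine ⟨max N (-(p * H.m)), fun c hc => (hN c fun j i k hik => ?_).tail ⟨H, rfl, ?_⟩⟩
    · have := hc j i k hik
      have := le_max_left N (-(p * H.m))
      omega
    · refine iff_of_false hab ?_
      have := hc H.j _ _ hH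
      have := le_max_right N (-(p * H.m))
      simp only [Hyp.Above, Hyp.ht]
      omega

theorem exists_antidominant (hp : 0 < p) (N : ℤ) :
    ∃ c : Wtf n f, ∀ (j : Fin f) (i k : Fin n), i < k →
      val p c j i - val p c j k < -N := by
  refine ⟨transl fun _ i => (|N| + 2) * i, fun j i k hik => ?_⟩
  have h1 : (i : ℤ) + 1 ≤ k := by
    have : (i : ℕ) < k := hik
    omega
  have h2 : (p : ℤ) * ((|N| + 2) * i) - p * ((|N| + 2) * k) + (k - i) =
      -((p * (|N| + 2) - 1) * (k - i)) := by ring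
  have h3 : 1 * (|N| + 2) ≤ p * (|N| + 2) := by gcongr; omega
  have h4 : (|N| + 1) * 1 ≤ (p * (|N| + 2) - 1) * ((k : ℤ) - i) :=
    mul_le_mul (by linarith) (by linarith) zero_le_one (by linarith [abs_nonneg N])
  have h5 := le_abs_self N
  simp only [val, transl, eta0, inv_one, Equiv.Perm.one_apply]
  linarith

theorem br_of_up (hnp : n < p) {a b t : Wtf n f} (ha : Dominant p a) (hb : Dominant p b)
    (h : Up p b t) : Br p (ofW (w0f n f) * a) b t := by
  obtain ⟨N, hN⟩ := h.exists_br
  obtain ⟨M, hM⟩ := (Set.finite_range fun q : Fin f × Fin n × Fin n =>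
    val p a q.1 q.2.1 - val p a q.1 q.2.2).bddAbove
  obtain ⟨c, hc⟩ := exists_antidominant (n := n) (f := f) (p := p) (by omega) (max N M)
  refine (hN c fun j i k hik => ?_).change_base hnp fun H hH => ?_
  · have := hc j i k hik
    have := le_max_left N M
    omega
  · rw [← Hyp.sep_norm hnp] at hH ⊢
    have h1 := hc H.norm.j _ _ H.norm_pos
    have h2 := le_max_right N M
    have h3 := ha H.norm.j _ _ (Fin.rev_lt_rev.2 H.norm_pos)
    have h4 := hb H.norm.j _ _ H.norm_pos
    have h5 : val p a H.norm.j H.norm.k.rev - val p a H.norm.j H.norm.i.rev ≤ M :=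
      hM ⟨(H.norm.j, H.norm.k.rev, H.norm.i.rev), rfl⟩
    have h6 : ∀ l, (w0f n f H.norm.j)⁻¹ l = l.rev := fun l => by simp [w0f]
    simp only [Hyp.Sep, Hyp.Above, Hyp.ht, val_ofW_mul, h6] at hH ⊢
    omega

theorem Factors.mem_Adm (hnp : n < p) {a : Wtf n f} (h : Factors p a) :
    a ∈ Adm p (etaf n f) := by
  obtain ⟨w', w1, w2, h1, h2, hup, rfl⟩ := h
  have hw0 : ofW (w0f n f) * ofW (w0f n f) = (1 : Wtf n f) := by
    rw [← ofW_mul, ← ofW_one]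
    congr 1
    funext j
    ext i
    simp [w0f]
  have e1 : Br p w2 (ofW (w0f n f) * w1) (ofW (w0f n f) * ((whElt n f)⁻¹ * w2)) := by
    have := (br_of_up hnp h2 h1 hup).act (ofW (w0f n f))
    rwa [← mul_assoc, hw0, one_mul] at this
  have e2 : Br p w2 (ofW w' * w1) (ofW (w0f n f) * w1) := by
    obtain ⟨u, hu1, hu2⟩ := exists_extremal hnp (BStep p w2) (-1) (Or.inr rfl) (ofW w' * w1)
      fun b H hH hm hb => ⟨H, rfl, iff_of_true (by rw [Hyp.Above]; linarith)
        (by have := h2 H.j _ _ hH; rw [Hyp.Above, Hyp.ht, hm]; linarith)⟩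
    rw [← mul_assoc, ← ofW_mul] at hu1 hu2
    have hu3 : u * w' = w0f n f :=
      eq_w0f_of_antidominant h1 fun j i k hik => by have := hu2 j i k hik; linarith
    rwa [hu3] at hu1
  refine ⟨fun j => (w2.w j)⁻¹ * Fin.revPerm, Br.bruhatLE hnp ?_⟩
  have e3 := Br.act (e2.trans e1) w2⁻¹
  rwa [inv_mul_cancel, ← mul_transl_eq (a := w2)
    (σ := fun j => (w2.w j)⁻¹ * Fin.revPerm) (fun j => by simp), inv_mul_cancel_left] at e3

/-- `w̃ ∈ Adm(η)` if and only if there exist `w' ∈ Wf` and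
`w̃₁, w̃₂ ∈ Wtf⁺` with `w̃₁ ↑ w̃_h⁻¹ w̃₂` such that `w̃ = w̃₂⁻¹ w' w̃₁`. -/
theorem statement13 (n f p : ℕ) (hn : 2 ≤ n) (hf : 1 ≤ f) (hp : p.Prime) (hnp : n < p)
    (a : Wtf n f) :
    a ∈ Adm p (etaf n f) ↔
      ∃ (w' : WfG n f) (w1 w2 : Wtf n f),
        w1 ∈ WtfPlus n f p ∧ w2 ∈ WtfPlus n f p ∧
        upOrd p w1 (Wtf.mul (Wtf.inv (whElt n f)) w2) ∧
        a = Wtf.mul (Wtf.inv w2) (Wtf.mul (ofW w') w1) := by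
  constructor
  · rintro ⟨σ, h⟩
    obtain ⟨w', w1, w2, h1, h2, h3, h4⟩ := factors_of_bruhatLE hnp h (factors_transl hnp σ)
    exact ⟨w', w1, w2, (mem_WtfPlus_iff w1).2 h1, (mem_WtfPlus_iff w2).2 h2,
      (upOrd_iff hnp _ _).2 h3, h4⟩
  · rintro ⟨w', w1, w2, h1, h2, h3, h4⟩
    exact Factors.mem_Adm hnp ⟨w', w1, w2, (mem_WtfPlus_iff w1).1 h1, (mem_WtfPlus_iff w2).1 h2,
      (upOrd_iff hnp _ _).1 h3, h4⟩

end LLLSerre
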